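/- arXiv:2410.13728 — 2 statements merged into one kernel-verified Lean document; each statement's English description precedes it below -/
import Mathlib

section
/- Let A be a Deligne-finite k-linear abelian category over an algebraically closed field k, with simple objects S_1,…,S_n and projective covers P_1,…,P_n. Then the endomorphism algebra End_A(P_1 ⊕ … ⊕ P_n) is a quasi-hereditary algebra if, and only if, A is highest weight with respect to some ordering of its simple objects. -/
open CategoryTheory CategoryTheory.Limits

universe v u

namespace HWPaper

variable {C : Type u} [Category.{v} C]

/-- `p : P ⟶ X` exhibits `P` as a projective cover of `X`:
`P` is projective, `p` is epi, and `p` is a superfluous epimorphism. -/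
def IsProjCover (P X : C) (p : P ⟶ X) : Prop :=
  Projective P ∧ Epi p ∧ ∀ ⦃Y : C⦄ (f : Y ⟶ P), Epi (f ≫ p) → Epi f

/-- `ι : X ⟶ I` exhibits `I` as an injective hull of `X`. -/
def IsInjHull (X I : C) (ι : X ⟶ I) : Prop :=
  Injective I ∧ Mono ι ∧ ∀ ⦃Y : C⦄ (f : I ⟶ Y), Mono (ι ≫ f) → Mono f

/-- `q : P ⟶ D` exhibits `D` as the maximal quotient of `P` lying in the class `mem`:
every quotient of `P` lying in `mem` factors through `q`. -/
def IsMaxQuotientIn (mem : C → Prop) (P D : C) (q : P ⟶ D) : Prop :=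
  Epi q ∧ mem D ∧ ∀ ⦃Q : C⦄ (e : P ⟶ Q), Epi e → mem Q → ∃ r : D ⟶ Q, q ≫ r = e

/-- `m : N ⟶ I` exhibits `N` as the maximal subobject of `I` lying in the class `mem`. -/
def IsMaxSubobjectIn (mem : C → Prop) (I N : C) (m : N ⟶ I) : Prop :=
  Mono m ∧ mem N ∧ ∀ ⦃M : C⦄ (s : M ⟶ I), Mono s → mem M → ∃ r : M ⟶ N, r ≫ m = s

/-- The extension closure of a class of objects in an abelian category. -/
inductive ExtClosure [Abelian C] (P : C → Prop) : C → Prop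
  | of (X : C) : P X → ExtClosure P X
  | zero (X : C) : IsZero X → ExtClosure P X
  | ext (S : ShortComplex C) : S.ShortExact → ExtClosure P S.X₁ → ExtClosure P S.X₃ →
      ExtClosure P S.X₂

variable (C) in
/-- The subgroup of relations coming from short exact sequences. -/
def K0Relations [Abelian C] : AddSubgroup (FreeAbelianGroup C) :=
  AddSubgroup.closure {x | ∃ S : ShortComplex C, S.ShortExact ∧
    x = FreeAbelianGroup.of S.X₂ - FreeAbelianGroup.of S.X₁ - FreeAbelianGroup.of S.X₃}

variable (C) in
/-- The Grothendieck group of an abelian category. -/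
def K0 [Abelian C] : Type u := FreeAbelianGroup C ⧸ K0Relations C

noncomputable instance [Abelian C] : AddCommGroup (K0 C) :=
  QuotientAddGroup.Quotient.addCommGroup _

/-- The class of an object in the Grothendieck group. -/
def K0.cls [Abelian C] (X : C) : K0 C := QuotientAddGroup.mk (FreeAbelianGroup.of X)

/-- The data of a Deligne-finite `k`-linear abelian category with an ordering
`S 0, …, S (n-1)` of its simple objects, together with projective covers, injective hulls,
standard and costandard objects, and the Jordan–Hölder multiplicity function. -/
structure DeligneData (k : Type v) [Field k] [IsAlgClosed k]
    (C : Type u) [Category.{v} C] [Abelian C] [Linear k C] [EnoughProjectives C]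
    (n : ℕ) where
  /-- the simple objects -/
  S : Fin n → C
  /-- the projective covers -/
  P : Fin n → C
  /-- the injective hulls -/
  I : Fin n → C
  /-- the standard objects -/
  Δ : Fin n → C
  /-- the costandard objects -/
  nabla : Fin n → C
  /-- the projective cover maps -/
  p : ∀ i, P i ⟶ S i
  /-- the injective hull maps -/
  ι : ∀ i, S i ⟶ I i
  /-- the quotient maps onto the standard objects -/
  q : ∀ i, P i ⟶ Δ i
  /-- the inclusions of the costandard objects -/
  m : ∀ i, nabla i ⟶ I i
  /-- the Jordan–Hölder multiplicity `[X : S j]` -/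
  mult : C → Fin n → ℕ
  homFinite : ∀ X Y : C, FiniteDimensional k (X ⟶ Y)
  ext1Finite : ∀ X Y : C, FiniteDimensional k (((Ext k C 1).obj (Opposite.op X)).obj Y)
  simple : ∀ i, Simple (S i)
  distinct : ∀ i j, Nonempty (S i ≅ S j) → i = j
  exhaustive : ∀ X : C, Simple X → ∃ i, Nonempty (X ≅ S i)
  projCover : ∀ i, IsProjCover (P i) (S i) (p i)
  injHull : ∀ i, IsInjHull (S i) (I i) (ι i)
  std : ∀ i, IsMaxQuotientIn (ExtClosure (fun X => ∃ j, j ≤ i ∧ Nonempty (X ≅ S j)))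
      (P i) (Δ i) (q i)
  costd : ∀ i, IsMaxSubobjectIn (ExtClosure (fun X => ∃ j, j ≤ i ∧ Nonempty (X ≅ S j)))
      (I i) (nabla i) (m i)
  mult_simple : ∀ i j, mult (S i) j = if i = j then 1 else 0
  mult_additive : ∀ T : ShortComplex C, T.ShortExact →
      ∀ j, mult T.X₂ j = mult T.X₁ j + mult T.X₃ j
  mult_eq_zero_iff : ∀ X : C, (∀ j, mult X j = 0) ↔ IsZero X

variable {k : Type v} [Field k] [IsAlgClosed k] [Abelian C] [Linear k C]
  [EnoughProjectives C] {n : ℕ}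

/-- The Serre subcategory `A_i`, i.e. the extension closure of `S 0, …, S i`. -/
def DeligneData.serre (D : DeligneData k C n) (i : Fin n) : C → Prop :=
  ExtClosure (fun X => ∃ j, j ≤ i ∧ Nonempty (X ≅ D.S j))

/-- `A` is a highest-weight category with respect to the given ordering of its simple
objects: `End (Δ i) ≅ k` and each `P i` lies in the extension closure of `Δ i, …, Δ (n-1)`. -/
def DeligneData.IsHighestWeight (D : DeligneData k C n) : Prop :=
  ∀ i, Nonempty (End (D.Δ i) ≃ₐ[k] k) ∧
    ExtClosure (fun X => ∃ j, i ≤ j ∧ Nonempty (X ≅ D.Δ j)) (D.P i)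


attribute [local instance] CategoryTheory.Abelian.hasFiniteBiproducts

/-- The image of the two-sided ideal `J` under the (surjective) ring homomorphism `f` is a
heredity ideal: it is idempotent, it is killed by the Jacobson radical on both sides, and
it is projective as a left module. -/
def IsHeredityIdealIn {Λ Λ' : Type*} [Ring Λ] [Ring Λ'] (f : Λ →+* Λ')
    (J : TwoSidedIdeal Λ) : Prop :=
  (∀ x ∈ J, f x ∈ AddSubgroup.closure {y : Λ' | ∃ a ∈ J, ∃ b ∈ J, y = f a * f b}) ∧
  (∀ a ∈ J, ∀ r ∈ (⊥ : Ideal Λ').jacobson, ∀ b ∈ J, f a * r * f b = 0) ∧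
  Module.Projective Λ' (Ideal.span (f '' (J : Set Λ)))

/-- A ring is quasi-hereditary if it admits a chain of two-sided ideals
`0 = J 0 ⊆ J 1 ⊆ ⋯ ⊆ J m = Λ` such that the image of each `J (l+1)` in `Λ / J l` is a
heredity ideal. -/
def IsQuasiHereditary (Λ : Type*) [Ring Λ] : Prop :=
  ∃ (m : ℕ) (J : Fin (m + 1) → TwoSidedIdeal Λ), Monotone J ∧
    J 0 = ⊥ ∧ J (Fin.last m) = ⊤ ∧
    ∀ l : Fin m, IsHeredityIdealIn (RingCon.mk' (J l.castSucc).ringCon) (J l.succ)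

/-- `A` is highest weight with respect to the reordering of its simple objects by the
permutation `σ`, i.e. for the ordering `S (σ 0), …, S (σ (n-1))`: there are standard
objects `Δσ i` (maximal quotients of `P (σ i)` in the Serre subcategory generated by
`S (σ 0), …, S (σ i)`) with `End (Δσ i) ≅ k` and
`P (σ i) ∈ ⟨Δσ i, …, Δσ (n-1)⟩`. -/
def DeligneData.IsHighestWeightFor (D : DeligneData k C n) (σ : Equiv.Perm (Fin n)) :
    Prop :=
  ∃ (Δσ : Fin n → C) (qσ : ∀ i, D.P (σ i) ⟶ Δσ i),
    (∀ i, IsMaxQuotientIn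
      (ExtClosure (fun X => ∃ j, j ≤ i ∧ Nonempty (X ≅ D.S (σ j))))
      (D.P (σ i)) (Δσ i) (qσ i)) ∧
    ∀ i, Nonempty (End (Δσ i) ≃ₐ[k] k) ∧
      ExtClosure (fun X => ∃ j, i ≤ j ∧ Nonempty (X ≅ Δσ j)) (D.P (σ i))

section Alg

open Module

variable {K B : Type*} [Field K] [Ring B] [Algebra K B]

/-- the map `x ↦ a x b` -/
def sand (K : Type*) {B : Type*} [Field K] [Ring B] [Algebra K B] (a b : B) : B →ₗ[K] B :=
  (LinearMap.mulLeft K a) ∘ₗ (LinearMap.mulRight K b)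

@[simp] lemma sand_apply (a b x : B) : sand K a b x = a * (x * b) := rfl

/-- left projectivity of `BeB` forces the multiplication map to be injective -/
lemma core_ineq [FiniteDimensional K B] {ι : Type*} [Fintype ι] (e : ι → B)
    (he : ∀ i, e i * e i = e i)
    (hne : ∀ i j, i ≠ j → ∀ x, e i * x * e j = 0)
    (heq : ∀ i x, ∃ c : K, e i * x * e i = c • e i)
    (M : Ideal B) (hM : M = Ideal.span {y | ∃ i b, y = e i * b})
    [Module.Projective B M] (a : B) :
    ∑ i, finrank K (LinearMap.range (sand K a (e i))) *
        finrank K (LinearMap.range (sand K (e i) 1)) ≤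
      finrank K ((M.restrictScalars K).map (LinearMap.mulLeft K a)) := by
  classical
  let β : ι → ℕ := fun i => finrank K (LinearMap.range (sand K (e i) 1))
  let bs : ∀ i, Basis (Fin (β i)) K (LinearMap.range (sand K (e i) 1)) := fun i => finBasis K _
  let c := Σ i, Fin (β i)
  let x : c → B := fun t => (bs t.1 t.2 : B)
  have hx : ∀ t : c, e t.1 * x t = x t := by
    rintro ⟨i, j⟩
    obtain ⟨y, hy⟩ := (bs i j).2
    simp only [x, ← hy, sand_apply, mul_one, ← mul_assoc, he]
  have hxM : ∀ t : c, x t ∈ M := by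
    intro t
    rw [hM]
    exact Ideal.subset_span ⟨t.1, x t, (hx t).symm⟩
  -- every e_i b is a combination
  have hspan : ∀ i b, ∃ l : Fin (β i) → K, e i * b = ∑ j, l j • x ⟨i, j⟩ := by
    intro i b
    refine ⟨fun j => (bs i).repr ⟨e i * b, ⟨b, by simp⟩⟩ j, ?_⟩
    have := congrArg (Subtype.val) ((bs i).sum_repr ⟨e i * b, ⟨b, by simp⟩⟩)
    simp only [AddSubmonoidClass.coe_finsetSum, Submodule.coe_smul] at this
    exact this.symm
  let φ : (c → B) →ₗ[B] M :=
    ∑ t : c, (LinearMap.toSpanSingleton B M ⟨x t, hxM t⟩) ∘ₗ (LinearMap.proj t)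
  have hφ : ∀ y, (φ y : B) = ∑ t, y t * x t := by
    intro y
    simp [φ]
  have hsurj : Function.Surjective φ := by
    rintro ⟨m, hm⟩
    have : m ∈ Submodule.map M.subtype (LinearMap.range φ) := by
      have hle : M ≤ Submodule.map M.subtype (LinearMap.range φ) := by
        conv_lhs => rw [hM]
        rw [Ideal.span_le]
        rintro _ ⟨i, b, rfl⟩
        obtain ⟨l, hl⟩ := hspan i b
        refine ⟨φ (fun t => if h : t.1 = i then algebraMap K B (l (h ▸ t.2)) else 0), ⟨_, rfl⟩, ?_⟩
        simp only [Submodule.coe_subtype, hφ, hl]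
        rw [Fintype.sum_sigma, Finset.sum_eq_single i]
        · simp [Algebra.smul_def]
        · intro b _ hb
          simp [hb]
        · simp
      exact hle hm
    obtain ⟨_, ⟨y, rfl⟩, hy⟩ := this
    exact ⟨y, Subtype.ext hy⟩
  obtain ⟨ψ, hψ⟩ := Module.projective_lifting_property φ LinearMap.id hsurj
  have hψ' : ∀ m, φ (ψ m) = m := fun m => by simpa using congrArg (fun f => f m) hψ
  -- key
  have key : ∀ t t' : c, ψ ⟨x t, hxM t⟩ t' * e t'.1 = if t = t' then e t.1 else 0 := by
    intro t
    set w : c → B := ψ ⟨x t, hxM t⟩ with hw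
    have hw1 : ∀ t', e t.1 * w t' = w t' := by
      intro t'
      have : (e t.1) • (⟨x t, hxM t⟩ : M) = ⟨x t, hxM t⟩ := Subtype.ext (hx t)
      have h2 := congrArg (fun m => ψ m t') this
      simp only [map_smul, Pi.smul_apply, smul_eq_mul] at h2
      exact h2
    have hw2 : ∑ t', w t' * x t' = x t := by
      rw [← hφ, hψ']
    obtain ⟨i, j⟩ := t
    have h3 : ∀ j', ∃ l : K, w ⟨i, j'⟩ * e i = l • e i := by
      intro j'
      obtain ⟨l, hl⟩ := heq i (w ⟨i, j'⟩)
      exact ⟨l, by rw [← hl]; rw [hw1 ⟨i, j'⟩]⟩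
    have h4 : ∀ t' : c, t'.1 ≠ i → w t' * e t'.1 = 0 := by
      intro t' ht'
      rw [← hw1 t']
      exact hne i t'.1 (Ne.symm ht') _
    choose l hl using h3
    have h5 : ∑ j', l j' • x ⟨i, j'⟩ = x ⟨i, j⟩ := by
      rw [← hw2, Fintype.sum_sigma, Finset.sum_eq_single i]
      · refine Finset.sum_congr rfl fun j' _ => ?_
        rw [← hx ⟨i, j'⟩, ← mul_assoc, hl, smul_mul_assoc]
      · intro i' _ hi'
        refine Finset.sum_eq_zero fun j' _ => ?_
        rw [← hx ⟨i', j'⟩, ← mul_assoc, h4 ⟨i', j'⟩ hi', zero_mul]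
      · simp
    have h6 : ∑ j', l j' • bs i j' = bs i j := by
      apply Subtype.ext
      simpa using h5
    have h7 : ∀ j', l j' = if j = j' then 1 else 0 := by
      intro j'
      have := congrArg (fun v => (bs i).repr v j') h6
      simp [Finsupp.single_apply] at this
      simpa [Finsupp.single_apply, Finset.sum_ite_eq] using this
    rintro ⟨i', j'⟩
    by_cases hi : i' = i
    · subst hi
      simp only [hl, h7]
      by_cases hj : j = j'
      · subst hj; simp
      · rw [if_neg hj, zero_smul, if_neg]
        intro h
        exact hj (eq_of_heq (Sigma.mk.inj h).2)
    · rw [h4 ⟨i', j'⟩ hi, if_neg]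
      intro h
      exact hi (congrArg Sigma.fst h).symm
  -- the injective map
  let Ψ : (∀ t : c, LinearMap.range (sand K a (e t.1))) →ₗ[K]
      ((M.restrictScalars K).map (LinearMap.mulLeft K a)) :=
    LinearMap.codRestrict _
      (∑ t : c, (LinearMap.mulRight K (x t)) ∘ₗ (Submodule.subtype _) ∘ₗ (LinearMap.proj t)) (by
        intro y
        rw [LinearMap.sum_apply]
        refine Submodule.sum_mem _ fun t _ => ?_
        obtain ⟨z, hz⟩ := (y t).2
        refine ⟨z * x t, M.mul_mem_left _ (hxM t), ?_⟩
        simp only [LinearMap.comp_apply, LinearMap.proj_apply, Submodule.coe_subtype,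
          LinearMap.mulRight_apply, LinearMap.mulLeft_apply, ← hz, sand_apply, mul_assoc, hx])
  have hΨ : ∀ y, (Ψ y : B) = ∑ t, (y t : B) * x t := by
    intro y
    simp [Ψ]
  have hinj : Function.Injective Ψ := by
    rw [← LinearMap.ker_eq_bot, LinearMap.ker_eq_bot']
    intro y hy
    have h0 : ∑ t, (y t : B) * x t = 0 := by rw [← hΨ, hy]; rfl
    have h1 : ∑ t, (y t : B) • (⟨x t, hxM t⟩ : M) = 0 := by
      apply Subtype.ext
      simpa using h0
    ext t'
    have h2 := congrArg (fun m => ψ m t' * e t'.1) h1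
    simp only [map_sum, map_smul, Finset.sum_apply, Pi.smul_apply, smul_eq_mul, Finset.sum_mul,
      mul_assoc, key, map_zero, Pi.zero_apply, zero_mul] at h2
    have h3 : ∑ t : c, (y t : B) * (if t = t' then e t.1 else 0) = (y t' : B) * e t'.1 := by
      rw [Finset.sum_eq_single t']
      · rw [if_pos rfl]
      · intro t _ ht
        rw [if_neg ht, mul_zero]
      · simp
    rw [h3] at h2
    obtain ⟨z, hz⟩ := (y t').2
    rw [← hz] at h2 ⊢
    simpa [mul_assoc, he] using h2
  have := LinearMap.finrank_le_finrank_of_injective hinj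
  refine le_trans (le_of_eq ?_) this
  rw [Module.finrank_pi_fintype, Fintype.sum_sigma]
  refine Finset.sum_congr rfl fun i _ => ?_
  have h : ∑ _y : Fin (β i), finrank K ↥(LinearMap.range (sand K a (e i))) =
      β i * finrank K ↥(LinearMap.range (sand K a (e i))) := by simp
  exact (mul_comm _ _).trans h.symm

/-- the multiplication map from copies of `Be` to `BeB` -/
lemma core_proj [FiniteDimensional K B] (e : B) (he : e * e = e)
    (M : Ideal B) (hM : M = Ideal.span {y | ∃ b, y = e * b}) :
    finrank K (M.restrictScalars K) ≤
      finrank K (LinearMap.range (sand K 1 e)) * finrank K (LinearMap.range (sand K e 1)) ∧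
    (finrank K (LinearMap.range (sand K 1 e)) * finrank K (LinearMap.range (sand K e 1)) ≤
      finrank K (M.restrictScalars K) → Module.Projective B M) := by
  classical
  let c := Fin (finrank K (LinearMap.range (sand K e 1)))
  let bs : Basis c K (LinearMap.range (sand K e 1)) := finBasis K _
  let x : c → B := fun t => (bs t : B)
  have hx : ∀ t : c, e * x t = x t := by
    intro j
    obtain ⟨y, hy⟩ := (bs j).2
    simp only [x, ← hy, sand_apply, mul_one, ← mul_assoc, he]
  have hxM : ∀ t : c, x t ∈ M := by
    intro t
    rw [hM]
    exact Ideal.subset_span ⟨x t, (hx t).symm⟩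
  have hspan : ∀ b, ∃ l : c → K, e * b = ∑ j, l j • x j := by
    intro b
    refine ⟨fun j => bs.repr ⟨e * b, ⟨b, by simp⟩⟩ j, ?_⟩
    have := congrArg (Subtype.val) (bs.sum_repr ⟨e * b, ⟨b, by simp⟩⟩)
    simp only [AddSubmonoidClass.coe_finsetSum, Submodule.coe_smul] at this
    exact this.symm
  let N : Ideal B := Ideal.span {e}
  have hN : ∀ y, y ∈ N ↔ y * e = y := by
    intro y
    rw [Ideal.mem_span_singleton']
    constructor
    · rintro ⟨z, rfl⟩; rw [mul_assoc, he]
    · intro h; exact ⟨y, h⟩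
  have hNr : N.restrictScalars K = LinearMap.range (sand K 1 e) := by
    ext y
    simp only [Submodule.restrictScalars_mem, hN, LinearMap.mem_range, sand_apply, one_mul]
    constructor
    · intro h; exact ⟨y, h⟩
    · rintro ⟨z, rfl⟩; rw [mul_assoc, he]
  let φ : (c → N) →ₗ[B] M :=
    ∑ t : c, (LinearMap.toSpanSingleton B M ⟨x t, hxM t⟩) ∘ₗ N.subtype ∘ₗ (LinearMap.proj t)
  have hφ : ∀ y, (φ y : B) = ∑ t, (y t : B) * x t := by
    intro y
    simp [φ]
  have hsurj : Function.Surjective φ := by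
    rintro ⟨m, hm⟩
    have : m ∈ Submodule.map M.subtype (LinearMap.range φ) := by
      have hle : M ≤ Submodule.map M.subtype (LinearMap.range φ) := by
        conv_lhs => rw [hM]
        rw [Ideal.span_le]
        rintro _ ⟨b, rfl⟩
        obtain ⟨l, hl⟩ := hspan b
        refine ⟨φ (fun t => ⟨l t • e, (hN _).2 (by rw [smul_mul_assoc, he])⟩), ⟨_, rfl⟩, ?_⟩
        simp only [Submodule.coe_subtype, hφ, hl]
        simp [hx]
      exact hle hm
    obtain ⟨_, ⟨y, rfl⟩, hy⟩ := this
    exact ⟨y, Subtype.ext hy⟩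
  let φK : (c → N.restrictScalars K) →ₗ[K] M.restrictScalars K :=
    { toFun := fun y => φ y
      map_add' := fun a b => φ.map_add a b
      map_smul' := fun r a => by
        apply Subtype.ext
        have h1 := hφ (fun i => r • a i)
        have h2 := hφ a
        refine h1.trans ?_
        simp only [RingHom.id_apply]
        refine Eq.trans ?_ (congrArg (fun z => r • z) h2.symm)
        simp [Finset.smul_sum] }
  have hdim : finrank K (c → N.restrictScalars K) =
      finrank K (LinearMap.range (sand K 1 e)) * finrank K (LinearMap.range (sand K e 1)) := by
    rw [Module.finrank_pi_fintype, hNr]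
    simp [c, mul_comm]
  have hsurjK : Function.Surjective φK := hsurj
  constructor
  · rw [← hdim]
    exact LinearMap.finrank_le_finrank_of_surjective hsurjK
  · intro hle
    have hfe : finrank K (c → N.restrictScalars K) = finrank K (M.restrictScalars K) := by
      apply le_antisymm
      · rw [hdim]; exact hle
      · exact LinearMap.finrank_le_finrank_of_surjective hsurjK
    have hinj : Function.Injective φ :=
      (LinearMap.injective_iff_surjective_of_finrank_eq_finrank hfe).2 hsurjK
    have : Module.Projective B N := by
      refine Module.Projective.of_split (M := B) N.subtype
        (LinearMap.codRestrict N (LinearMap.toSpanSingleton B B e) ?_) ?_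
      · intro y
        rw [hN]; simp [mul_assoc, he]
      · ext y
        simpa using (hN y.1).1 y.2
    have : Module.Projective B (c → N) :=
      Module.Projective.of_equiv (DFinsupp.linearEquivFunOnFintype (R := B) (M := fun _ : c => N))
    exact Module.Projective.of_equiv (LinearEquiv.ofBijective φ ⟨hinj, hsurj⟩)

end Alg
section Alg2

open Module

variable {K Λ B : Type*} [Field K] [Ring Λ] [Algebra K Λ] [Ring B] [Algebra K B] {n : ℕ}

/-- dimension of the Peirce component `aΛb` modulo `J` -/
noncomputable def pd (K : Type*) {Λ : Type*} [Field K] [Ring Λ] [Algebra K Λ]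
    (J : Submodule K Λ) (a b : Λ) : ℕ :=
  finrank K ((LinearMap.range (sand K a b)).map J.mkQ)

/-- the two-sided ideal generated by the `e t`, `t ∈ E`, as a subspace -/
def TI (K : Type*) {Λ : Type*} [Field K] [Ring Λ] [Algebra K Λ] {n : ℕ}
    (e : Fin n → Λ) (E : Set (Fin n)) : Submodule K Λ :=
  Submodule.span K {x | ∃ a t b, t ∈ E ∧ x = a * e t * b}

/-- the indices at least `m` -/
def Up (n m : ℕ) : Set (Fin n) := {t | m ≤ t.val}

lemma TI_mem (e : Fin n → Λ) {E : Set (Fin n)} {t : Fin n} (ht : t ∈ E) (a b : Λ) :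
    a * e t * b ∈ TI K e E := Submodule.subset_span ⟨a, t, b, ht, rfl⟩

lemma TI_mem' (e : Fin n → Λ) {E : Set (Fin n)} {t : Fin n} (ht : t ∈ E) :
    e t ∈ TI K e E := by simpa using TI_mem (K := K) e ht 1 1

lemma TI_mono (e : Fin n → Λ) {E E' : Set (Fin n)} (h : E ⊆ E') : TI K e E ≤ TI K e E' := by
  apply Submodule.span_mono
  rintro x ⟨a, t, b, ht, rfl⟩
  exact ⟨a, t, b, h ht, rfl⟩

lemma TI_mul_left (e : Fin n → Λ) {E : Set (Fin n)} (c x : Λ) (hx : x ∈ TI K e E) :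
    c * x ∈ TI K e E := by
  have : TI K e E ≤ (TI K e E).comap (LinearMap.mulLeft K c) := by
    conv_lhs => unfold TI
    rw [Submodule.span_le]
    rintro _ ⟨a, t, b, ht, rfl⟩
    have := TI_mem (K := K) e ht (c * a) b
    simpa [mul_assoc] using this
  exact this hx

lemma TI_mul_right (e : Fin n → Λ) {E : Set (Fin n)} (c x : Λ) (hx : x ∈ TI K e E) :
    x * c ∈ TI K e E := by
  have : TI K e E ≤ (TI K e E).comap (LinearMap.mulRight K c) := by
    conv_lhs => unfold TI
    rw [Submodule.span_le]
    rintro _ ⟨a, t, b, ht, rfl⟩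
    have := TI_mem (K := K) e ht a (b * c)
    simpa [mul_assoc] using this
  exact this hx

lemma TI_le {e : Fin n → Λ} {E : Set (Fin n)} {J : Submodule K Λ}
    (h : ∀ a b, ∀ t ∈ E, a * e t * b ∈ J) : TI K e E ≤ J := by
  unfold TI
  rw [Submodule.span_le]
  rintro _ ⟨a, t, b, ht, rfl⟩
  exact h a b t ht

/-- `TI` as a two-sided ideal -/
def TIideal (K : Type*) {Λ : Type*} [Field K] [Ring Λ] [Algebra K Λ] {n : ℕ}
    (e : Fin n → Λ) (E : Set (Fin n)) : TwoSidedIdeal Λ :=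
  TwoSidedIdeal.mk' (TI K e E) (TI K e E).zero_mem (fun h h' => (TI K e E).add_mem h h')
    (fun h => (TI K e E).neg_mem h) (fun h => TI_mul_left e _ _ h)
    (fun h => TI_mul_right e _ _ h)

lemma mem_TIideal {e : Fin n → Λ} {E : Set (Fin n)} {x : Λ} :
    x ∈ TIideal K e E ↔ x ∈ TI K e E := by
  unfold TIideal
  rw [TwoSidedIdeal.mem_mk']
  rfl

lemma map_sand (f : Λ →ₐ[K] B) (hf : Function.Surjective f) (a b : Λ) :
    (LinearMap.range (sand K a b)).map f.toLinearMap =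
      LinearMap.range (sand K (f a) (f b)) := by
  ext y
  constructor
  · rintro ⟨_, ⟨x, rfl⟩, rfl⟩
    exact ⟨f x, by simp⟩
  · rintro ⟨y, rfl⟩
    obtain ⟨x, rfl⟩ := hf y
    exact ⟨_, ⟨x, rfl⟩, by simp⟩

lemma pd_eq (f : Λ →ₐ[K] B) (hf : Function.Surjective f) (J : Submodule K Λ)
    (hJ : ∀ x, x ∈ J ↔ f x = 0) (a b : Λ) :
    pd K J a b = finrank K (LinearMap.range (sand K (f a) (f b))) := by
  have hk : J = LinearMap.ker f.toLinearMap := by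
    ext x; simp [hJ]
  subst hk
  rw [← map_sand f hf]
  let g := f.toLinearMap.quotKerEquivOfSurjective hf
  have : f.toLinearMap = g.toLinearMap ∘ₗ (LinearMap.ker f.toLinearMap).mkQ := by
    ext x; rfl
  unfold pd
  conv_rhs => rw [this, Submodule.map_comp]
  exact (LinearEquiv.finrank_map_eq g _).symm

lemma pd_mono [FiniteDimensional K Λ] {J J' : Submodule K Λ} (h : J ≤ J') (a b : Λ) :
    pd K J' a b ≤ pd K J a b := by
  unfold pd
  have : J'.mkQ = (Submodule.factor h) ∘ₗ J.mkQ := by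
    ext x; simp
  rw [this, Submodule.map_comp]
  exact Submodule.finrank_map_le _ _

lemma finrank_map_add_le [FiniteDimensional K Λ] (f : Λ →ₗ[K] B) (S S' : Submodule K Λ)
    (h : S' ≤ S) (h' : S' ≤ LinearMap.ker f) :
    finrank K (S.map f) + finrank K S' ≤ finrank K S := by
  rw [← LinearMap.finrank_range_add_finrank_ker (f.domRestrict S), LinearMap.range_domRestrict]
  gcongr
  rw [← (Submodule.comapSubtypeEquivOfLe h).finrank_eq]
  apply Submodule.finrank_mono
  intro x hx
  exact h' hx

lemma finrank_map_add_eq [FiniteDimensional K Λ] (f : Λ →ₗ[K] B) (S S' : Submodule K Λ)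
    (h : S' ≤ S) (h' : S' = LinearMap.ker f) :
    finrank K (S.map f) + finrank K S' = finrank K S := by
  rw [← LinearMap.finrank_range_add_finrank_ker (f.domRestrict S), LinearMap.range_domRestrict]
  congr 1
  rw [← (Submodule.comapSubtypeEquivOfLe h).finrank_eq]
  have : Submodule.comap S.subtype S' = LinearMap.ker (f.domRestrict S) := by
    subst h'
    ext x
    simp
  rw [this]

lemma sum_telescope_le (m : ℕ) (D : Fin (m + 1) → ℕ) (c : Fin m → ℕ)
    (h : ∀ l, c l + D l.castSucc ≤ D l.succ) : ∑ l, c l + D 0 ≤ D (Fin.last m) := by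
  induction m with
  | zero => simp
  | succ m ih =>
    rw [Fin.sum_univ_castSucc]
    have h1 := ih (fun l => D l.castSucc) (fun l => c l.castSucc) (fun l => h l.castSucc)
    have h2 := h (Fin.last m)
    simp only [Fin.castSucc_zero, Fin.succ_last, Nat.succ_eq_add_one] at h1 h2
    omega

lemma sum_telescope_eq (m : ℕ) (D : ℕ → ℕ) (c : Fin m → ℕ)
    (h : ∀ l : Fin m, c l + D (l + 1) = D l) : ∑ l, c l + D m = D 0 := by
  induction m with
  | zero => simp
  | succ m ih =>
    rw [Fin.sum_univ_castSucc]
    have h1 := ih (fun l => c l.castSucc) (fun l => h l.castSucc)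
    have h2 := h (Fin.last m)
    simp only [Fin.val_last] at h2
    omega

lemma mkQ_zero_iff (J : TwoSidedIdeal Λ) (x : Λ) :
    RingCon.mk' J.ringCon x = 0 ↔ x ∈ J := by
  rw [TwoSidedIdeal.mem_iff, ← map_zero (RingCon.mk' J.ringCon)]
  exact RingCon.eq _

/-- quotient map as an algebra map -/
def qmap (K : Type*) {Λ : Type*} [Field K] [Ring Λ] [Algebra K Λ] (J : TwoSidedIdeal Λ) :
    Λ →ₐ[K] J.ringCon.Quotient :=
  { RingCon.mk' J.ringCon with commutes' := fun _ => rfl }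

lemma qmap_coe (J : TwoSidedIdeal Λ) (x : Λ) : qmap K J x = RingCon.mk' J.ringCon x := rfl

lemma qmap_surj (J : TwoSidedIdeal Λ) : Function.Surjective (qmap K J) :=
  RingCon.mk'_surjective _

/-- first numerical condition -/
def N1 (K : Type*) {Λ : Type*} [Field K] [Ring Λ] [Algebra K Λ] {n : ℕ} (e : Fin n → Λ) : Prop :=
  ∀ s : Fin n, pd K (TI K e (Up n (s + 1))) (e s) (e s) ≤ 1

/-- second numerical condition -/
def N2 (K : Type*) {Λ : Type*} [Field K] [Ring Λ] [Algebra K Λ] {n : ℕ} (e : Fin n → Λ)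
    (a : Λ) : Prop :=
  ∑ s : Fin n, pd K (TI K e (Up n (s + 1))) a (e s) * pd K (TI K e (Up n (s + 1))) (e s) 1 ≤
    finrank K (LinearMap.range (sand K a 1))

lemma jac_map (f : Λ →+* B) (hf : Function.Surjective f) {r : Λ} (hr : r ∈ Ring.jacobson Λ) :
    f r ∈ (⊥ : Ideal B).jacobson := by
  rw [Ideal.jacobson_bot]
  have : RingHomSurjective f := ⟨hf⟩
  exact Ring.le_comap_jacobson f hr

/-- left ideal spanned by the image of a generated two-sided ideal -/
lemma span_image (f : Λ →ₐ[K] B) (hf : Function.Surjective f) (e : Fin n → Λ)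
    (E : Set (Fin n)) :
    Ideal.span (f '' (TI K e E : Set Λ)) = Ideal.span {y | ∃ t ∈ E, ∃ b, y = f (e t) * b} := by
  apply le_antisymm
  · rw [Ideal.span_le]
    rintro _ ⟨x, hx, rfl⟩
    have : TI K e E ≤ Submodule.comap f.toLinearMap
        ((Ideal.span {y | ∃ t ∈ E, ∃ b, y = f (e t) * b}).restrictScalars K) := by
      apply TI_le
      intro a b t ht
      simp only [Submodule.mem_comap, AlgHom.toLinearMap_apply, map_mul,
        Submodule.restrictScalars_mem, mul_assoc]
      exact Ideal.mul_mem_left _ _ (Ideal.subset_span ⟨t, ht, _, rfl⟩)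
    exact this hx
  · rw [Ideal.span_le]
    rintro _ ⟨t, ht, b, rfl⟩
    obtain ⟨b, rfl⟩ := hf b
    rw [← map_mul]
    exact Ideal.subset_span ⟨_, TI_mul_right e _ _ (TI_mem' e ht), rfl⟩

lemma span_image_restrict (f : Λ →ₐ[K] B) (hf : Function.Surjective f) (J : Submodule K Λ)
    (hJ : ∀ a x, x ∈ J → a * x ∈ J) :
    (Ideal.span (f '' (J : Set Λ))).restrictScalars K = J.map f.toLinearMap := by
  apply le_antisymm
  · intro y hy
    have hy' : y ∈ Ideal.span (f '' (J : Set Λ)) := hy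
    clear hy
    induction hy' using Submodule.span_induction with
    | mem x h =>
      obtain ⟨z, hz, rfl⟩ := h
      exact ⟨z, hz, rfl⟩
    | zero => exact Submodule.zero_mem _
    | add x y _ _ hx hy => exact Submodule.add_mem _ hx hy
    | smul a x _ hx =>
      obtain ⟨z, hz, rfl⟩ := hx
      obtain ⟨a, rfl⟩ := hf a
      exact ⟨a * z, hJ _ _ hz, by simp⟩
  · rintro _ ⟨z, hz, rfl⟩
    exact Ideal.subset_span ⟨z, hz, rfl⟩

/-- One step of the heredity chain. -/
lemma heredity_step [FiniteDimensional K Λ] [FiniteDimensional K B] (e : Fin n → Λ)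
    (he : ∀ i, e i * e i = e i)
    (s : Fin n) (f : Λ →ₐ[K] B) (hf : Function.Surjective f)
    (hk : ∀ x, x ∈ TI K e (Up n (s + 1)) ↔ f x = 0)
    (h1 : pd K (TI K e (Up n (s + 1))) (e s) (e s) ≤ 1)
    (h2 : pd K (TI K e (Up n (s + 1))) 1 (e s) * pd K (TI K e (Up n (s + 1))) (e s) 1 +
      finrank K (TI K e (Up n (s + 1))) ≤ finrank K (TI K e (Up n s)))
    (J : TwoSidedIdeal Λ) (hJ : ∀ x, x ∈ J ↔ x ∈ TI K e (Up n s)) :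
    IsHeredityIdealIn (f : Λ →+* B) J := by
  have hzero : ∀ t : Fin n, t ∈ Up n s → t = s ∨ f (e t) = 0 := by
    intro t ht
    by_cases h : t = s
    · exact Or.inl h
    · right
      rw [← hk]
      apply TI_mem'
      have : (s : ℕ) ≤ t := ht
      have : (t : ℕ) ≠ s := fun h' => h (Fin.ext h')
      show (s : ℕ) + 1 ≤ t
      omega
  refine ⟨?_, ?_, ?_⟩
  · intro x hx
    rw [hJ] at hx
    suffices ∀ c : K, f (c • x) ∈
        AddSubgroup.closure {y : B | ∃ a ∈ J, ∃ b ∈ J, y = f a * f b} by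
      simpa using this 1
    unfold TI at hx
    induction hx using Submodule.span_induction with
    | mem x h =>
      obtain ⟨a, t, b, ht, rfl⟩ := h
      intro c
      apply AddSubgroup.subset_closure
      refine ⟨c • (a * e t), ?_, e t * b, ?_, ?_⟩
      · rw [hJ]; exact Submodule.smul_mem _ _ (TI_mul_left e _ _ (TI_mem' e ht))
      · rw [hJ]; exact (TI_mul_right e _ _ (TI_mem' e ht))
      · rw [← map_mul, smul_mul_assoc]
        congr 2
        rw [← mul_assoc, mul_assoc a (e t) (e t), he]
    | zero => intro c; simp
    | add x y _ _ hx hy =>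
      intro c
      rw [smul_add, map_add]
      exact AddSubgroup.add_mem _ (hx c) (hy c)
    | smul a x _ hx =>
      intro c
      rw [smul_smul]
      exact hx _
  · have key : ∀ r ∈ (⊥ : Ideal B).jacobson, f (e s) * r * f (e s) = 0 := by
      intro r hr
      have hin : f (e s) * r * f (e s) ∈ (⊥ : Ideal B).jacobson := by
        rw [Ideal.jacobson_bot] at hr ⊢
        exact Ideal.mul_mem_right _ _ (Ideal.mul_mem_left _ _ hr)
      rw [pd_eq f hf _ hk] at h1
      set V := LinearMap.range (sand K (f (e s)) (f (e s))) with hV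
      have hid : f (e s) * f (e s) = f (e s) := by rw [← map_mul, he]
      have m1 : f (e s) * r * f (e s) ∈ V := ⟨r, by simp [mul_assoc]⟩
      have m2 : f (e s) ∈ V := ⟨f (e s), by simp [hid]⟩
      by_contra hne
      have hfr : finrank K V = 1 := by
        apply le_antisymm h1
        rw [Nat.succ_le_iff, Module.finrank_pos_iff_exists_ne_zero]
        exact ⟨⟨_, m1⟩, fun h => hne (congrArg Subtype.val h)⟩
      obtain ⟨c, hc⟩ := exists_smul_eq_of_finrank_eq_one hfr
        (x := (⟨_, m1⟩ : V)) (fun h => hne (congrArg Subtype.val h)) ⟨_, m2⟩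
      have hc' : c • (f (e s) * r * f (e s)) = f (e s) := congrArg Subtype.val hc
      have hin2 : f (e s) ∈ (⊥ : Ideal B).jacobson := by
        rw [← hc', Algebra.smul_def]
        exact Ideal.mul_mem_left _ _ hin
      obtain ⟨z, hz⟩ := Ideal.mem_jacobson_iff.1 hin2 (-1)
      have hz' : z * (1 - f (e s)) = 1 := by
        have := (Submodule.mem_bot B).1 hz
        rw [mul_sub, mul_one]
        rw [sub_eq_zero] at this
        rw [← this]; simp [add_comm, sub_eq_add_neg]
      have : f (e s) = 0 := by
        calc f (e s) = z * (1 - f (e s)) * f (e s) := by rw [hz', one_mul]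
          _ = 0 := by rw [mul_assoc, sub_mul, hid, one_mul, sub_self, mul_zero]
      apply hne
      rw [this]; simp
    have key2 : ∀ b ∈ TI K e (Up n s), ∀ r ∈ (⊥ : Ideal B).jacobson, f (e s) * r * f b = 0 := by
      intro b hb r hr
      have : TI K e (Up n s) ≤
          LinearMap.ker (LinearMap.mulLeft K (f (e s) * r) ∘ₗ f.toLinearMap) := by
        apply TI_le
        intro a' b' t ht
        simp only [LinearMap.mem_ker, LinearMap.comp_apply, AlgHom.toLinearMap_apply,
          LinearMap.mulLeft_apply, map_mul]
        rcases hzero t ht with rfl | h0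
        · have := key (r * f a') (by
            rw [Ideal.jacobson_bot] at hr ⊢
            exact Ideal.mul_mem_right _ _ hr)
          calc _ = (f (e t) * (r * f a') * f (e t)) * f b' := by simp only [mul_assoc]
            _ = 0 := by rw [this, zero_mul]
        · rw [h0]; simp
      exact this hb
    intro a ha r hr b hb
    rw [hJ] at ha hb
    have : TI K e (Up n s) ≤
        LinearMap.ker (LinearMap.mulRight K (r * f b) ∘ₗ f.toLinearMap) := by
      apply TI_le
      intro a' b' t ht
      simp only [LinearMap.mem_ker, LinearMap.comp_apply, AlgHom.toLinearMap_apply,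
        LinearMap.mulRight_apply, map_mul]
      rcases hzero t ht with rfl | h0
      · have := key2 b hb (f b' * r) (Ideal.mul_mem_left _ _ hr)
        calc _ = f a' * (f (e t) * (f b' * r) * f b) := by simp only [mul_assoc]
          _ = 0 := by rw [this, mul_zero]
      · rw [h0]; simp
    have := this ha
    simpa [mul_assoc] using this
  · have hset : (J : Set Λ) = (TI K e (Up n s) : Set Λ) := by
      ext x; exact hJ x
    have hM : Ideal.span (f '' (J : Set Λ)) = Ideal.span {y | ∃ b, y = f (e s) * b} := by
      rw [hset, span_image f hf]
      apply le_antisymm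
      · rw [Ideal.span_le]
        rintro _ ⟨t, ht, b, rfl⟩
        rcases hzero t ht with rfl | h0
        · exact Ideal.subset_span ⟨b, rfl⟩
        · rw [h0, zero_mul]; exact Ideal.zero_mem _
      · apply Ideal.span_mono
        rintro _ ⟨b, rfl⟩
        exact ⟨s, le_refl (s : ℕ), b, rfl⟩
    refine (core_proj (K := K) (f (e s)) (by rw [← map_mul, he]) _ hM).2 ?_
    rw [hset, span_image_restrict f hf _ (fun a x hx => TI_mul_left e a x hx)]
    rw [pd_eq f hf _ hk, pd_eq f hf _ hk, map_one] at h2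
    have h3 := finrank_map_add_eq f.toLinearMap (TI K e (Up n s)) (TI K e (Up n (s + 1)))
      (TI_mono e (fun t ht => le_trans (Nat.le_succ _) ht)) (by ext x; simp [hk])
    omega

theorem qh_of_N [FiniteDimensional K Λ] (e : Fin n → Λ) (he : ∀ i, e i * e i = e i)
    (hsum : ∑ i, e i = 1) (h1 : N1 K e) (h2 : N2 K e 1) : IsQuasiHereditary Λ := by
  have htop : TI K e (Up n 0) = ⊤ := by
    rw [eq_top_iff]
    intro x _
    rw [← mul_one x, ← hsum]
    exact TI_mul_left e _ _ (Submodule.sum_mem _ fun i _ => TI_mem' e (Nat.zero_le _))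
  have hbot : TI K e (Up n n) = ⊥ := by
    rw [eq_bot_iff]
    apply TI_le
    intro a b t ht
    exact absurd t.2 (not_lt.2 ht)
  have hfin : ∀ J : TwoSidedIdeal Λ, FiniteDimensional K J.ringCon.Quotient := fun J =>
    Module.Finite.of_surjective (qmap K J).toLinearMap (qmap_surj (K := K) J)
  -- the inequality for each step
  have hstep : ∀ s : Fin n, finrank K ((TI K e (Up n s)).map (qmap K (TIideal K e (Up n (s+1)))).toLinearMap) ≤
      pd K (TI K e (Up n (s + 1))) 1 (e s) * pd K (TI K e (Up n (s + 1))) (e s) 1 := by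
    intro s
    set f := qmap K (TIideal K e (Up n (s+1))) with hf
    have hk : ∀ x, x ∈ TI K e (Up n (s + 1)) ↔ f x = 0 := by
      intro x
      rw [hf, qmap_coe, mkQ_zero_iff, mem_TIideal]
    rw [pd_eq f (qmap_surj _) _ hk, pd_eq f (qmap_surj _) _ hk, map_one]
    rw [← span_image_restrict f (qmap_surj _) _ (fun a x hx => TI_mul_left e a x hx)]
    refine (core_proj (K := K) (f (e s)) (by rw [← map_mul, he]) _ ?_).1
    rw [span_image f (qmap_surj _)]
    apply le_antisymm
    · rw [Ideal.span_le]
      rintro _ ⟨t, ht, b, rfl⟩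
      by_cases h : t = s
      · subst h; exact Ideal.subset_span ⟨b, rfl⟩
      · have : f (e t) = 0 := by
          rw [← hk]
          apply TI_mem'
          have : (s : ℕ) ≤ t := ht
          have : (t : ℕ) ≠ s := fun h' => h (Fin.ext h')
          show (s : ℕ) + 1 ≤ t
          omega
        rw [this, zero_mul]; exact Ideal.zero_mem _
    · apply Ideal.span_mono
      rintro _ ⟨b, rfl⟩
      exact ⟨s, le_refl (s : ℕ), b, rfl⟩
  have hadd : ∀ s : Fin n,
      finrank K ((TI K e (Up n s)).map (qmap K (TIideal K e (Up n (s+1)))).toLinearMap) +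
        finrank K (TI K e (Up n (s + 1))) = finrank K (TI K e (Up n s)) := by
    intro s
    apply finrank_map_add_eq
    · exact TI_mono e (fun t ht => le_trans (Nat.le_succ _) ht)
    · ext x
      rw [LinearMap.mem_ker, AlgHom.toLinearMap_apply, qmap_coe, mkQ_zero_iff, mem_TIideal]
  have htel := sum_telescope_eq n (fun m => finrank K (TI K e (Up n m))) _ hadd
  beta_reduce at htel
  rw [htop, hbot, finrank_bot, add_zero, finrank_top] at htel
  have hr : LinearMap.range (sand K (1 : Λ) 1) = ⊤ := by
    rw [LinearMap.range_eq_top]; intro x; exact ⟨x, by simp⟩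
  unfold N2 at h2
  rw [hr, finrank_top, ← htel] at h2
  have heq := (Finset.sum_eq_sum_iff_of_le (fun s _ => hstep s)).1
    (le_antisymm (Finset.sum_le_sum fun s _ => hstep s) h2)
  refine ⟨n, fun l => TIideal K e (Up n (n - l)), ?_, ?_, ?_, ?_⟩
  · intro l l' hl x hx
    rw [mem_TIideal] at hx ⊢
    refine TI_mono e (fun t ht => ?_) hx
    have : (l : ℕ) ≤ l' := hl
    have h : n - l ≤ t := ht
    show n - l' ≤ (t : ℕ)
    omega
  · ext x
    rw [mem_TIideal]
    simp [hbot]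
  · ext x
    rw [mem_TIideal]
    simp [htop]
  · intro l
    let s : Fin n := l.rev
    have e1 : n - (l.castSucc : ℕ) = s + 1 := by simp [s, Fin.val_rev]; omega
    have e2 : n - (l.succ : ℕ) = s := by simp [s, Fin.val_rev]
    have key : ∀ a b : ℕ, a = s + 1 → b = s →
        IsHeredityIdealIn (RingCon.mk' (TIideal K e (Up n a)).ringCon) (TIideal K e (Up n b)) := by
      rintro _ _ rfl rfl
      exact heredity_step e he s (qmap K (TIideal K e (Up n (s+1)))) (qmap_surj _)
        (fun x => by rw [qmap_coe, mkQ_zero_iff, mem_TIideal]) (h1 s)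
        (by rw [← hadd s, heq s (Finset.mem_univ _)]) (TIideal K e (Up n s))
        (fun x => mem_TIideal)
    exact key _ _ e1 e2

end Alg2
section Alg3

open Module

variable {K Λ : Type*} [Field K] [Ring Λ] [Algebra K Λ] {n : ℕ}

lemma jac_inv {r : Λ} (hr : r ∈ Ring.jacobson Λ) : ∃ z : Λ, z * (1 + r) = 1 := by
  rw [← Ideal.jacobson_bot] at hr
  obtain ⟨z, hz⟩ := Ideal.mem_jacobson_iff.1 hr 1
  refine ⟨z, ?_⟩
  have := (Submodule.mem_bot Λ).1 hz
  rw [sub_eq_zero] at this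
  rw [mul_one] at this
  rw [mul_add, mul_one, add_comm, this]

lemma tsi_smul (J : TwoSidedIdeal Λ) (c : K) {x : Λ} (hx : x ∈ J) : c • x ∈ J := by
  rw [Algebra.smul_def]; exact J.mul_mem_left _ _ hx

lemma chain_step [FiniteDimensional K Λ] (e : Fin n → Λ) (he : ∀ i, e i * e i = e i)
    (hsum : ∑ i, e i = 1)
    (H1 : ∀ i j, i ≠ j → ∀ x, e i * x * e j ∈ Ring.jacobson Λ)
    (H2 : ∀ i x, ∃ c : K, e i * x * e i - c • e i ∈ Ring.jacobson Λ)
    (J' J : TwoSidedIdeal Λ)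
    (E : Set (Fin n)) (hE : ∀ i, i ∈ E ↔ e i ∈ J)
    (hJ' : ∀ x ∈ J', x ∈ TI K e E)
    (hJ : IsHeredityIdealIn (RingCon.mk' J'.ringCon) J) : ∀ x ∈ J, x ∈ TI K e E := by
  have hone : ∀ x ∈ J, ∃ y ∈ TI K e E, x - y ∈ Ring.jacobson Λ := by
    intro x hx
    have hij : ∀ i j, ∃ y ∈ TI K e E, e i * x * e j - y ∈ Ring.jacobson Λ := by
      intro i j
      by_cases h : i = j
      · subst h
        by_cases hi : i ∈ E
        · exact ⟨e i * x * e i, TI_mul_left e _ _ (TI_mem' e hi), by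
            rw [sub_self]; exact Submodule.zero_mem _⟩
        · obtain ⟨c, hc⟩ := H2 i x
          by_cases hc0 : c = 0
          · subst hc0
            exact ⟨0, Submodule.zero_mem _, by simpa using hc⟩
          · exfalso
            apply hi
            rw [hE]
            set r := e i * x * e i - c • e i with hr
            have hr' : c⁻¹ • r ∈ Ring.jacobson Λ := by
              rw [Algebra.smul_def]; exact Ideal.mul_mem_left _ _ hc
            obtain ⟨z, hz⟩ := jac_inv hr'
            have h1 : e i + c⁻¹ • r = c⁻¹ • (e i * x * e i) := by
              rw [hr, smul_sub, smul_smul, inv_mul_cancel₀ hc0, one_smul]; abel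
            have h2 : e i + c⁻¹ • r ∈ J := by
              rw [h1]
              exact tsi_smul J _ (J.mul_mem_right _ _ (J.mul_mem_left _ _ hx))
            have h3 : e i = z * (e i + c⁻¹ • r) * e i := by
              have : z * (1 + c⁻¹ • r) * e i = e i := by rw [hz, one_mul]
              conv_lhs => rw [← this]
              simp only [mul_add, add_mul, mul_assoc, he, mul_one]
            rw [h3]
            exact J.mul_mem_right _ _ (J.mul_mem_left _ _ h2)
      · exact ⟨0, Submodule.zero_mem _, by simpa using H1 i j h x⟩
    choose y hy hy' using hij
    refine ⟨∑ i, ∑ j, y i j, Submodule.sum_mem _ fun i _ => Submodule.sum_mem _ fun j _ => hy i j, ?_⟩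
    have : x = ∑ i, ∑ j, e i * x * e j := by
      simp only [← Finset.mul_sum, ← Finset.sum_mul, hsum, one_mul, mul_one]
    have h' : x - ∑ i, ∑ j, y i j = ∑ i, ∑ j, e i * x * e j - ∑ i, ∑ j, y i j :=
      congrArg (fun t => t - ∑ i, ∑ j, y i j) this
    rw [h']
    simp only [← Finset.sum_sub_distrib]
    exact Submodule.sum_mem _ fun i _ => Submodule.sum_mem _ fun j _ => hy' i j
  have hall : ∀ N : ℕ, ∀ x ∈ J, ∃ y ∈ TI K e E, x - y ∈ (Ring.jacobson Λ) ^ (N + 1) := by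
    intro N
    induction N with
    | zero =>
      rw [zero_add, Submodule.pow_one]
      exact hone
    | succ N ih =>
      intro x hx
      have hcl : ∀ z ∈ AddSubgroup.closure {y | ∃ a ∈ J, ∃ b ∈ J,
          y = RingCon.mk' J'.ringCon a * RingCon.mk' J'.ringCon b},
          ∃ w, RingCon.mk' J'.ringCon w = z ∧ ∃ y ∈ TI K e E,
            w - y ∈ (Ring.jacobson Λ) ^ (N + 1 + 1) := by
        intro z hz
        induction hz using AddSubgroup.closure_induction with
        | mem z h =>
          obtain ⟨a, ha, b, hb, rfl⟩ := h
          obtain ⟨y1, hy1, hr1⟩ := ih a ha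
          obtain ⟨y2, hy2, hr2⟩ := hone b hb
          refine ⟨a * b, map_mul _ _ _, y1 * b + (a - y1) * y2,
            Submodule.add_mem _ (TI_mul_right e _ _ hy1) (TI_mul_left e _ _ hy2), ?_⟩
          have : a * b - (y1 * b + (a - y1) * y2) = (a - y1) * (b - y2) := by noncomm_ring
          rw [this, Submodule.pow_succ]
          exact Ideal.mul_mem_mul hr1 hr2
        | zero => exact ⟨0, map_zero _, 0, Submodule.zero_mem _, by simp⟩
        | add z z' _ _ h h' =>
          obtain ⟨w, rfl, y, hy, hw⟩ := h
          obtain ⟨w', rfl, y', hy', hw'⟩ := h'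
          refine ⟨w + w', map_add _ _ _, y + y', Submodule.add_mem _ hy hy', ?_⟩
          have := Ideal.add_mem _ hw hw'
          rwa [sub_add_sub_comm] at this
        | neg z _ h =>
          obtain ⟨w, rfl, y, hy, hw⟩ := h
          refine ⟨-w, map_neg _ _, -y, Submodule.neg_mem _ hy, ?_⟩
          have := Submodule.neg_mem _ hw
          rwa [neg_sub, ← neg_sub_neg] at this
      obtain ⟨w, hw, y, hy, hwy⟩ := hcl _ (hJ.1 x hx)
      have hxw : x - w ∈ J' := by
        rw [← mkQ_zero_iff, map_sub, hw, sub_self]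
      refine ⟨y + (x - w), Submodule.add_mem _ hy (hJ' _ hxw), ?_⟩
      have : x - (y + (x - w)) = w - y := by abel
      rwa [this]
  have hart : IsArtinianRing Λ := IsArtinianRing.of_finite K Λ
  obtain ⟨N, hN⟩ := IsSemiprimaryRing.isNilpotent (R := Λ)
  intro x hx
  obtain ⟨y, hy, hxy⟩ := hall N x hx
  rw [Submodule.pow_succ, hN] at hxy
  have : x - y = 0 := by simpa using hxy
  rw [sub_eq_zero.1 this]; exact hy

/-- quasi-hereditary algebras satisfy the numerical conditions in some order -/
theorem N_of_qh [FiniteDimensional K Λ] (e : Fin n → Λ) (he : ∀ i, e i * e i = e i)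
    (hne0 : ∀ i, e i ≠ 0) (hsum : ∑ i, e i = 1)
    (H1 : ∀ i j, i ≠ j → ∀ x, e i * x * e j ∈ Ring.jacobson Λ)
    (H2 : ∀ i x, ∃ c : K, e i * x * e i - c • e i ∈ Ring.jacobson Λ)
    (hqh : IsQuasiHereditary Λ) :
    ∃ σ : Equiv.Perm (Fin n), N1 K (e ∘ σ) ∧ ∀ a, N2 K (e ∘ σ) a := by
  classical
  obtain ⟨m, J, hmono, h0, htop, hher⟩ := hqh
  let E : Fin (m + 1) → Set (Fin n) := fun l => {i | e i ∈ J l}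
  have hEle : ∀ l, ∀ x ∈ TI K e (E l), x ∈ J l := by
    intro l x hx
    unfold TI at hx
    induction hx using Submodule.span_induction with
    | mem x h =>
      obtain ⟨a, t, b, ht, rfl⟩ := h
      exact (J l).mul_mem_right _ _ ((J l).mul_mem_left _ _ ht)
    | zero => exact (J l).zero_mem
    | add x y _ _ hx hy => exact (J l).add_mem hx hy
    | smul a x _ hx => exact tsi_smul _ _ hx
  have hleE : ∀ l, ∀ x ∈ J l, x ∈ TI K e (E l) := by
    intro l
    induction l using Fin.induction with
    | zero =>
      intro x hx
      rw [h0] at hx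
      have : x = 0 := by simpa using hx
      rw [this]; exact Submodule.zero_mem _
    | succ l ih =>
      refine chain_step e he hsum H1 H2 (J l.castSucc) (J l.succ) (E l.succ) (fun i => Iff.rfl)
        (fun x hx => ?_) (hher l)
      refine TI_mono e ?_ (ih x hx)
      intro i hi
      exact hmono (Fin.castSucc_lt_succ (i := l)).le hi
  have hJE : ∀ l x, x ∈ J l ↔ x ∈ TI K e (E l) := fun l x => ⟨hleE l x, hEle l x⟩
  have hd : ∀ i, ∃ l : Fin m, e i ∉ J l.castSucc ∧ e i ∈ J l.succ := by
    intro i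
    by_contra hcon
    push Not at hcon
    have : ∀ l, e i ∉ J l := by
      intro l
      induction l using Fin.induction with
      | zero =>
        intro h
        rw [h0] at h
        exact hne0 i (by simpa using h)
      | succ l ih => exact hcon l ih
    apply this (Fin.last m)
    rw [htop]; trivial
  choose d hd1 hd2 using hd
  have hdlt : ∀ i l, e i ∈ J l → (d i).castSucc < l := by
    intro i l h
    by_contra hcon
    exact hd1 i (hmono (not_lt.1 hcon) h)
  let σ : Equiv.Perm (Fin n) := Tuple.sort (OrderDual.toDual ∘ d)
  have hσ : ∀ s t, s ≤ t → d (σ t) ≤ d (σ s) := by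
    intro s t hst
    exact Tuple.monotone_sort (OrderDual.toDual ∘ d) hst
  have hTI : ∀ s : Fin n, TI K e (E (d (σ s)).castSucc) ≤ TI K (e ∘ σ) (Up n (s + 1)) := by
    intro s
    apply TI_le
    intro a b t ht
    have h := hdlt t _ ht
    rw [← σ.apply_symm_apply t]
    refine TI_mem (e ∘ σ) (t := σ.symm t) ?_ a b
    show (s : ℕ) + 1 ≤ (σ.symm t : ℕ)
    by_contra hcon
    have h3 : σ.symm t ≤ s := by
      show (σ.symm t : ℕ) ≤ s
      omega
    have := hσ _ _ h3
    rw [σ.apply_symm_apply] at this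
    exact absurd (Fin.castSucc_lt_castSucc_iff.1 h) (not_lt.2 this)
  have hfin : ∀ J : TwoSidedIdeal Λ, FiniteDimensional K J.ringCon.Quotient := fun J =>
    Module.Finite.of_surjective (qmap K J).toLinearMap (qmap_surj (K := K) J)
  have hker : ∀ (l : Fin m) x, x ∈ TI K e (E l.castSucc) ↔ qmap K (J l.castSucc) x = 0 := by
    intro l x
    rw [← hJE, qmap_coe, mkQ_zero_iff]
  have hzero : ∀ (l : Fin m) (i j : Fin n) (r : Λ), e i ∈ J l.succ → e j ∈ J l.succ →
      r ∈ Ring.jacobson Λ →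
      qmap K (J l.castSucc) (e i) * qmap K (J l.castSucc) r * qmap K (J l.castSucc) (e j) = 0 := by
    intro l i j r hi hj hr
    exact (hher l).2.1 _ hi _ (jac_map (RingCon.mk' (J l.castSucc).ringCon)
      (RingCon.mk'_surjective _) hr) _ hj
  have hdiag : ∀ (l : Fin m) (i : Fin n) (x : (J l.castSucc).ringCon.Quotient), e i ∈ J l.succ →
      ∃ c : K, qmap K (J l.castSucc) (e i) * x * qmap K (J l.castSucc) (e i) =
        c • qmap K (J l.castSucc) (e i) := by
    intro l i x hi
    obtain ⟨x, rfl⟩ := qmap_surj (K := K) _ x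
    obtain ⟨c, hc⟩ := H2 i x
    refine ⟨c, ?_⟩
    have := hzero l i i _ hi hi hc
    rw [← map_mul, ← map_mul] at this
    have h2 : e i * (e i * x * e i - c • e i) * e i = e i * x * e i - c • e i := by
      rw [mul_sub, sub_mul]
      congr 1
      · rw [← mul_assoc, ← mul_assoc, he, mul_assoc (e i * x), he]
      · rw [mul_smul_comm, smul_mul_assoc, he, he]
    rw [h2, map_sub, sub_eq_zero, map_smul] at this
    rw [← this, map_mul, map_mul]
  have hoff : ∀ (l : Fin m) (i j : Fin n) (x : (J l.castSucc).ringCon.Quotient), i ≠ j →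
      e i ∈ J l.succ → e j ∈ J l.succ →
      qmap K (J l.castSucc) (e i) * x * qmap K (J l.castSucc) (e j) = 0 := by
    intro l i j x hij hi hj
    obtain ⟨x, rfl⟩ := qmap_surj (K := K) _ x
    have := hzero l i j _ hi hj (H1 i j hij x)
    rw [← map_mul, ← map_mul] at this ⊢
    have h2 : e i * (e i * x * e j) * e j = e i * x * e j := by
      rw [← mul_assoc, ← mul_assoc, he, mul_assoc (e i * x), he]
    rwa [h2] at this
  refine ⟨σ, ?_, ?_⟩
  · intro s
    refine le_trans (pd_mono (hTI s) _ _) ?_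
    rw [pd_eq (qmap K (J (d (σ s)).castSucc)) (qmap_surj _) _ (hker _)]
    have : LinearMap.range (sand K (qmap K (J (d (σ s)).castSucc) ((e ∘ σ) s))
        (qmap K (J (d (σ s)).castSucc) ((e ∘ σ) s))) ≤
        Submodule.span K {qmap K (J (d (σ s)).castSucc) ((e ∘ σ) s)} := by
      rintro _ ⟨x, rfl⟩
      obtain ⟨c, hc⟩ := hdiag (d (σ s)) (σ s) x (hd2 _)
      rw [sand_apply, ← mul_assoc]
      exact Submodule.mem_span_singleton.2 ⟨c, hc.symm⟩
    refine le_trans (Submodule.finrank_mono this) ?_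
    refine le_trans (finrank_span_le_card _) ?_
    simp
  · intro a
    let g : Fin n → ℕ := fun i => pd K (TI K e (E (d i).castSucc)) a (e i) *
      pd K (TI K e (E (d i).castSucc)) (e i) 1
    have hlayer : ∀ l : Fin m, ∑ i : {i // d i = l}, g i +
        finrank K ((TI K e (E l.castSucc)).map (LinearMap.mulLeft K a)) ≤
        finrank K ((TI K e (E l.succ)).map (LinearMap.mulLeft K a)) := by
      intro l
      set f := qmap K (J l.castSucc) with hf
      have hmem : ∀ i : {i // d i = l}, e i ∈ J l.succ := by
        rintro ⟨i, rfl⟩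
        exact hd2 i
      have hset : (J l.succ : Set Λ) = (TI K e (E l.succ) : Set Λ) := by
        ext x; exact hJE _ x
      have hM : Ideal.span (f '' (J l.succ : Set Λ)) =
          Ideal.span {y | ∃ (i : {i // d i = l}) (b : _), y = f (e i) * b} := by
        rw [hset, span_image f (qmap_surj _)]
        apply le_antisymm
        · rw [Ideal.span_le]
          rintro _ ⟨t, ht, b, rfl⟩
          by_cases h : d t = l
          · exact Ideal.subset_span ⟨⟨t, h⟩, b, rfl⟩
          · have : f (e t) = 0 := by
              rw [← hker]
              apply TI_mem'
              have h1 : (d t).castSucc < l.succ := hdlt t _ ht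
              have h2 : (d t).succ ≤ l.castSucc := by
                rw [Fin.le_def]; rw [Fin.lt_def] at h1
                have h3 : (d t : ℕ) ≠ l := fun h' => h (Fin.ext h')
                simp at h1 ⊢
                omega
              exact hmono h2 (hd2 t)
            rw [this, zero_mul]; exact Ideal.zero_mem _
        · apply Ideal.span_mono
          rintro _ ⟨i, b, rfl⟩
          exact ⟨i, hmem i, b, rfl⟩
      have hproj : Module.Projective _ (Ideal.span (f '' (J l.succ : Set Λ))) := (hher l).2.2
      have hcore := @core_ineq K _ _ _ _ _ {i // d i = l} _ (fun i : {i // d i = l} => f (e i))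
        (fun i => by rw [← map_mul, he])
        (fun i j hij x => hoff l i j x (fun h => hij (Subtype.ext h)) (hmem i) (hmem j))
        (fun i x => hdiag l i x (hmem i)) _ hM hproj (f a)
      rw [hset, span_image_restrict f (qmap_surj _) _ (fun a x hx => TI_mul_left e a x hx),
        ← Submodule.map_comp] at hcore
      have hcomm : LinearMap.mulLeft K (f a) ∘ₗ f.toLinearMap =
          f.toLinearMap ∘ₗ LinearMap.mulLeft K a := by
        ext x; simp
      rw [hcomm, Submodule.map_comp] at hcore
      have hle := finrank_map_add_le f.toLinearMap
        ((TI K e (E l.succ)).map (LinearMap.mulLeft K a))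
        ((TI K e (E l.castSucc)).map (LinearMap.mulLeft K a))
        (Submodule.map_mono (TI_mono e (fun i hi => hmono (Fin.castSucc_lt_succ (i := l)).le hi)))
        (by
          rintro _ ⟨x, hx, rfl⟩
          rw [LinearMap.mem_ker, AlgHom.toLinearMap_apply, ← hker]
          exact TI_mul_left e _ _ hx)
      refine le_trans ?_ hle
      gcongr
      refine le_trans (le_of_eq ?_) hcore
      refine Finset.sum_congr rfl ?_
      rintro ⟨i, rfl⟩ _
      simp only [g]
      rw [pd_eq f (qmap_surj _) _ (hker _), pd_eq f (qmap_surj _) _ (hker _), map_one]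
    have htel := sum_telescope_le m
      (fun l => finrank K ((TI K e (E l)).map (LinearMap.mulLeft K a)))
      (fun l => ∑ i : {i // d i = l}, g i) hlayer
    rw [Fintype.sum_fiberwise] at htel
    unfold N2
    calc _ ≤ ∑ s, g (σ s) := Finset.sum_le_sum fun s _ =>
            Nat.mul_le_mul (pd_mono (hTI s) _ _) (pd_mono (hTI s) _ _)
      _ = ∑ i, g i := Equiv.sum_comp σ g
      _ ≤ _ := le_trans (Nat.le_add_right _ _) htel
      _ ≤ _ := by
        apply Submodule.finrank_mono
        rintro _ ⟨x, _, rfl⟩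
        exact ⟨x, by simp⟩

end Alg3
section Cat1

set_option linter.unusedSectionVars false

open Module

/-- The data extracted from a Deligne-finite category and an ordering of the simples. -/
structure Setup (k : Type v) [Field k] (C : Type u) [Category.{v} C] [Abelian C] [Linear k C]
    (n : ℕ) where
  /-- the generator -/
  G : C
  /-- indecomposable projectives -/
  Q : Fin n → C
  /-- simples -/
  S : Fin n → C
  /-- covers -/
  p : ∀ i, Q i ⟶ S i
  /-- inclusions -/
  inc : ∀ i, Q i ⟶ G
  /-- projections -/
  prj : ∀ i, G ⟶ Q i
  inc_prj : ∀ i, inc i ≫ prj i = 𝟙 _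
  inc_prj_ne : ∀ i j, i ≠ j → inc i ≫ prj j = 0
  sum_eq : ∑ i, prj i ≫ inc i = 𝟙 G
  /-- length -/
  len : C → ℕ
  len_add : ∀ T : ShortComplex C, T.ShortExact → len T.X₂ = len T.X₁ + len T.X₃
  len_zero : ∀ X, len X = 0 ↔ IsZero X
  homFinite : ∀ X Y : C, FiniteDimensional k (X ⟶ Y)
  simple : ∀ i, Simple (S i)
  distinct : ∀ i j, Nonempty (S i ≅ S j) → i = j
  exhaustive : ∀ X : C, Simple X → ∃ i, Nonempty (X ≅ S i)
  projCover : ∀ i, IsProjCover (Q i) (S i) (p i)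

namespace Setup

variable (D : Setup k C n)

lemma projQ (i : Fin n) : Projective (D.Q i) := (D.projCover i).1

lemma epi_p (i : Fin n) : Epi (D.p i) := (D.projCover i).2.1

lemma p_ne (i : Fin n) : D.p i ≠ 0 := by
  intro h
  have := D.simple i
  have := D.epi_p i
  apply id_nonzero (D.S i)
  rw [← cancel_epi (D.p i), h]; simp

lemma decomp {X : C} (f : D.G ⟶ X) : f = ∑ i, D.prj i ≫ D.inc i ≫ f := by
  conv_lhs => rw [← Category.id_comp f, ← D.sum_eq, Preadditive.sum_comp]
  simp

lemma decomp' {X : C} (f : X ⟶ D.G) : f = ∑ i, (f ≫ D.prj i) ≫ D.inc i := by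
  conv_lhs => rw [← Category.comp_id f, ← D.sum_eq, Preadditive.comp_sum]
  simp

lemma projG : Projective D.G := by
  constructor
  intro E X f e he
  have := D.projQ
  refine ⟨∑ i, D.prj i ≫ Projective.factorThru (D.inc i ≫ f) e, ?_⟩
  rw [Preadditive.sum_comp]
  conv_rhs => rw [D.decomp f]
  simp

lemma hom_simple {i j : Fin n} (f : D.Q i ⟶ D.S j) (hf : f ≠ 0) : i = j := by
  have := D.simple
  have hfe : Epi f := epi_of_nonzero_to_simple hf
  have h0 : kernel.ι f ≫ D.p i = 0 := by
    by_contra h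
    have h1 : Epi (kernel.ι f ≫ D.p i) := epi_of_nonzero_to_simple h
    have h2 := (D.projCover i).2.2 _ h1
    apply hf
    rw [← cancel_epi (kernel.ι f)]; simp
  let r := Abelian.epiDesc f (D.p i) h0
  have hr : f ≫ r = D.p i := Abelian.comp_epiDesc _ _ _
  have hr0 : r ≠ 0 := by
    intro h
    apply D.p_ne i
    rw [← hr, h, comp_zero]
  have := isIso_of_hom_simple hr0
  exact (D.distinct j i ⟨asIso r⟩).symm

lemma hom_simple_self {i : Fin n} (f : D.Q i ⟶ D.S i) : ∃ c : k, f = c • D.p i := by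
  by_cases hf : f = 0
  · exact ⟨0, by simp [hf]⟩
  have := D.simple
  have := D.homFinite
  have hfe : Epi f := epi_of_nonzero_to_simple hf
  have h0 : kernel.ι f ≫ D.p i = 0 := by
    by_contra h
    have h1 : Epi (kernel.ι f ≫ D.p i) := epi_of_nonzero_to_simple h
    have h2 := (D.projCover i).2.2 _ h1
    apply hf
    rw [← cancel_epi (kernel.ι f)]; simp
  let r := Abelian.epiDesc f (D.p i) h0
  have hr : f ≫ r = D.p i := Abelian.comp_epiDesc _ _ _
  have hr0 : r ≠ 0 := by
    intro h
    apply D.p_ne i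
    rw [← hr, h, comp_zero]
  have := isIso_of_hom_simple hr0
  obtain ⟨c, hc⟩ := endomorphism_simple_eq_smul_id k (inv r)
  refine ⟨c, ?_⟩
  have : f = D.p i ≫ inv r := by rw [← hr]; simp
  rw [this, ← hc]; simp

lemma len_lt_coker {X Y : C} (f : X ⟶ Y) [Mono f] (hX : ¬ IsZero X) :
    D.len (cokernel f) < D.len Y := by
  have h : (ShortComplex.mk f (cokernel.π f) (cokernel.condition f)).ShortExact :=
    { exact := ShortComplex.exact_cokernel f }
  have := D.len_add _ h
  have h2 : D.len X ≠ 0 := fun h => hX ((D.len_zero X).1 h)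
  dsimp at this
  omega

lemma len_lt_ker {X Y : C} (f : X ⟶ Y) [Epi f] (hY : ¬ IsZero Y) :
    D.len (kernel f) < D.len X := by
  have h : (ShortComplex.mk (kernel.ι f) f (kernel.condition f)).ShortExact :=
    { exact := ShortComplex.exact_kernel f }
  have := D.len_add _ h
  have h2 : D.len Y ≠ 0 := fun h => hY ((D.len_zero Y).1 h)
  dsimp at this
  omega

lemma simple_quot (m : ℕ) : ∀ X : C, D.len X ≤ m → ¬ IsZero X → ∃ j, ∃ q : X ⟶ D.S j, q ≠ 0 := by
  induction m with
  | zero =>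
    intro X hX h
    exact absurd ((D.len_zero X).1 (by omega)) h
  | succ m ih =>
    intro X hX h
    by_cases hs : Simple X
    · obtain ⟨i, ⟨a⟩⟩ := D.exhaustive X hs
      refine ⟨i, a.hom, ?_⟩
      intro h0
      apply h
      rw [IsZero.iff_id_eq_zero, ← a.hom_inv_id, h0, zero_comp]
    · have : ∃ (Y : C) (f : Y ⟶ X), Mono f ∧ f ≠ 0 ∧ ¬ IsIso f := by
        by_contra hcon
        push Not at hcon
        apply hs
        constructor
        intro Y f hf
        refine ⟨fun hi h0 => ?_, fun h0 => hcon Y f hf h0⟩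
        apply h
        have h1 := IsIso.inv_hom_id f
        rw [IsZero.iff_id_eq_zero, ← h1]
        exact (congrArg (fun z => inv f ≫ z) h0).trans comp_zero
      obtain ⟨Y, f, hf, hf0, hfi⟩ := this
      have hY : ¬ IsZero Y := fun h => hf0 (h.eq_of_src _ _)
      have hc : ¬ IsZero (cokernel f) := by
        intro h
        apply hfi
        have : Epi f := Preadditive.epi_of_cokernel_zero (h.eq_of_tgt _ _)
        exact isIso_of_mono_of_epi f
      obtain ⟨j, q, hq⟩ := ih _ (by have := D.len_lt_coker f hY; omega) hc
      refine ⟨j, cokernel.π f ≫ q, fun h0 => hq ?_⟩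
      rw [← cancel_epi (cokernel.π f), h0, comp_zero]

lemma exists_simple_quot (X : C) (h : ¬ IsZero X) : ∃ j, ∃ q : X ⟶ D.S j, Epi q ∧ q ≠ 0 := by
  obtain ⟨j, q, hq⟩ := D.simple_quot _ X le_rfl h
  have := D.simple
  exact ⟨j, q, epi_of_nonzero_to_simple hq, hq⟩

lemma exists_Q (X : C) (h : ¬ IsZero X) : ∃ j, ∃ f : D.Q j ⟶ X, f ≠ 0 := by
  obtain ⟨j, q, hq, _⟩ := D.exists_simple_quot X h
  have := D.projQ
  refine ⟨j, Projective.factorThru (D.p j) q, fun h0 => D.p_ne j ?_⟩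
  rw [← Projective.factorThru_comp (D.p j) q, h0, zero_comp]

lemma sep {X Y : C} (f : X ⟶ Y) (h : ∀ g : D.G ⟶ X, g ≫ f = 0) : f = 0 := by
  by_contra hf
  have hI : ¬ IsZero (image f) := by
    intro hz
    apply hf
    rw [← image.fac f, hz.eq_of_tgt (factorThruImage f) 0, zero_comp]
  obtain ⟨j, a, ha⟩ := D.exists_Q _ hI
  have := D.projQ
  apply ha
  have h1 := h (D.prj j ≫ Projective.factorThru a (factorThruImage f))
  have h2 : D.prj j ≫ a ≫ image.ι f = 0 := by
    have h5 : (D.prj j ≫ Projective.factorThru a (factorThruImage f)) ≫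
        (factorThruImage f ≫ image.ι f) = 0 := by rw [image.fac]; exact h1
    rw [← h5, Category.assoc, Projective.factorThru_comp_assoc]
  have h3 : D.inc j ≫ D.prj j ≫ a ≫ image.ι f = 0 := by rw [h2, comp_zero]
  rw [← Category.assoc, D.inc_prj, Category.id_comp] at h3
  rw [← cancel_mono (image.ι f), h3, zero_comp]

lemma mono_of_sep {X Y : C} (f : X ⟶ Y) (h : ∀ g : D.G ⟶ X, g ≫ f = 0 → g = 0) : Mono f := by
  apply Preadditive.mono_of_kernel_zero
  apply D.sep
  intro g
  apply h
  simp

lemma isZero_of_sep {X : C} (h : ∀ g : D.G ⟶ X, g = 0) : IsZero X := by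
  rw [IsZero.iff_id_eq_zero]
  apply D.sep
  intro g
  rw [h g, zero_comp]

/-- no maps from `Q t` for `t ≥ m` -/
def Van (m : ℕ) (X : C) : Prop := ∀ t : Fin n, m ≤ t → ∀ f : D.Q t ⟶ X, f = 0

variable {D} in
lemma Van.mono {m m' : ℕ} {X : C} (h : D.Van m X) (hm : m ≤ m') : D.Van m' X :=
  fun t ht f => h t (hm.trans ht) f

lemma serre_van {i : Fin n} {X : C}
    (h : ExtClosure (fun X => ∃ j, j ≤ i ∧ Nonempty (X ≅ D.S j)) X) : D.Van (i + 1) X := by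
  induction h with
  | of X h =>
    obtain ⟨j, hj, ⟨a⟩⟩ := h
    intro t ht f
    have : f ≫ a.hom = 0 := by
      by_contra h0
      have := D.hom_simple _ h0
      subst this
      rw [Fin.le_def] at hj
      omega
    rw [← cancel_mono a.hom, this, zero_comp]
  | zero X h =>
    intro t ht f
    exact h.eq_of_tgt _ _
  | ext T hT _ _ h1 h3 =>
    intro t ht f
    have h0 : f ≫ T.g = 0 := h3 t ht _
    have := hT.mono_f
    have h4 : hT.exact.lift f h0 = 0 := h1 t ht _
    rw [← hT.exact.lift_f f h0, h4, zero_comp]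

lemma van_serre_aux {i : Fin n} (m : ℕ) : ∀ X : C, D.len X ≤ m → D.Van (i + 1) X →
    ExtClosure (fun X => ∃ j, j ≤ i ∧ Nonempty (X ≅ D.S j)) X := by
  have := D.projQ
  induction m with
  | zero =>
    intro X hX _
    exact ExtClosure.zero _ ((D.len_zero X).1 (by omega))
  | succ m ih =>
    intro X hX hV
    by_cases hz : IsZero X
    · exact ExtClosure.zero _ hz
    obtain ⟨j, q, hq, hq0⟩ := D.exists_simple_quot X hz
    have hS : ¬ IsZero (D.S j) := fun h => hq0 (h.eq_of_tgt _ _)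
    have hT : (ShortComplex.mk (kernel.ι q) q (kernel.condition q)).ShortExact :=
      { exact := ShortComplex.exact_kernel q }
    refine ExtClosure.ext _ hT (ih _ ?_ ?_) (ExtClosure.of _ ⟨j, ?_, ⟨Iso.refl _⟩⟩)
    · have := D.len_lt_ker q hS
      dsimp; omega
    · intro t ht f
      dsimp at f
      rw [← cancel_mono (kernel.ι q), zero_comp]
      exact hV t ht _
    · by_contra hcon
      have h0 := hV j (by rw [Fin.le_def] at hcon; omega) (Projective.factorThru (D.p j) q)
      apply D.p_ne j
      rw [← Projective.factorThru_comp (D.p j) q, h0, zero_comp]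

lemma van_serre {i : Fin n} {X : C} (h : D.Van (i + 1) X) :
    ExtClosure (fun X => ∃ j, j ≤ i ∧ Nonempty (X ≅ D.S j)) X :=
  D.van_serre_aux _ X le_rfl h

lemma finEnd : FiniteDimensional k (End D.G) := D.homFinite D.G D.G

lemma jac_crit (x : End D.G) (hx : ∀ j (w : D.G ⟶ D.S j), (x : D.G ⟶ D.G) ≫ w = 0) :
    x ∈ Ring.jacobson (End D.G) := by
  have := D.finEnd
  have := D.projG
  rw [← Ideal.jacobson_bot, Ideal.mem_jacobson_iff]
  intro y
  let g : End D.G := 1 + y * x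
  have hg : ∀ j (w : D.G ⟶ D.S j), (g : D.G ⟶ D.G) ≫ w = w := by
    intro j w
    have h1 : (g : D.G ⟶ D.G) = 𝟙 _ + (x : D.G ⟶ D.G) ≫ (y : D.G ⟶ D.G) := rfl
    rw [h1, Preadditive.add_comp, Category.assoc, hx, add_zero, Category.id_comp]
  have hepi : Epi (C := C) (X := D.G) (Y := D.G) g := by
    apply Preadditive.epi_of_cokernel_zero
    by_contra hc
    have hz : ¬ IsZero (cokernel (C := C) (X := D.G) (Y := D.G) g) :=
      fun h => hc (h.eq_of_tgt _ _)
    obtain ⟨j, q, hq, hq0⟩ := D.exists_simple_quot _ hz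
    have h1 := hg j (cokernel.π (C := C) (X := D.G) (Y := D.G) g ≫ q)
    rw [← Category.assoc, cokernel.condition, zero_comp] at h1
    apply hq0
    rw [← cancel_epi (cokernel.π (C := C) (X := D.G) (Y := D.G) g), ← h1, comp_zero]
  let h : End D.G := Projective.factorThru (𝟙 D.G) (g : D.G ⟶ D.G)
  have hgh : g * h = 1 := Projective.factorThru_comp (𝟙 D.G) (g : D.G ⟶ D.G)
  have hart : IsArtinianRing (End D.G) := IsArtinianRing.of_finite k _
  have hhg : h * g = 1 := mul_eq_one_symm hgh
  refine ⟨h, ?_⟩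
  rw [Submodule.mem_bot, ← hhg]
  simp only [g]
  rw [mul_add, mul_one, mul_assoc]; abel

/-- the idempotents -/
def e (i : Fin n) : End D.G := D.prj i ≫ D.inc i

lemma e_idem (i : Fin n) : D.e i * D.e i = D.e i := by
  show (D.prj i ≫ D.inc i) ≫ (D.prj i ≫ D.inc i) = D.prj i ≫ D.inc i
  rw [Category.assoc, ← Category.assoc (D.inc i), D.inc_prj, Category.id_comp]

lemma e_ne (i : Fin n) : D.e i ≠ 0 := by
  intro h
  have h' : D.prj i ≫ D.inc i = 0 := h
  have h1 : D.inc i ≫ (D.prj i ≫ D.inc i) ≫ D.prj i = 𝟙 _ := by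
    rw [Category.assoc, ← Category.assoc, D.inc_prj, Category.id_comp]
  rw [h', zero_comp, comp_zero] at h1
  apply D.p_ne i
  rw [← Category.id_comp (D.p i), ← h1, zero_comp]

lemma e_sum : ∑ i, D.e i = 1 := D.sum_eq

lemma H1 (i j : Fin n) (hij : i ≠ j) (x : End D.G) :
    D.e i * x * D.e j ∈ Ring.jacobson (End D.G) := by
  apply D.jac_crit
  intro l w
  show ((D.prj j ≫ D.inc j) ≫ x ≫ (D.prj i ≫ D.inc i)) ≫ w = 0
  have : (D.inc j ≫ x ≫ D.prj i) ≫ (D.inc i ≫ w) = 0 := by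
    by_cases h : D.inc i ≫ w = 0
    · rw [h, comp_zero]
    · have := D.hom_simple _ h
      subst this
      by_contra h2
      exact hij (D.hom_simple _ h2).symm
  simp only [Category.assoc] at this ⊢
  rw [this, comp_zero]

lemma H2 (i : Fin n) (x : End D.G) :
    ∃ c : k, D.e i * x * D.e i - c • D.e i ∈ Ring.jacobson (End D.G) := by
  obtain ⟨c, hc⟩ := D.hom_simple_self ((D.inc i ≫ x ≫ D.prj i) ≫ D.p i)
  refine ⟨c, ?_⟩
  apply D.jac_crit
  intro l w
  show ((D.prj i ≫ D.inc i) ≫ x ≫ (D.prj i ≫ D.inc i) - c • (D.prj i ≫ D.inc i)) ≫ w = 0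
  have : (D.inc i ≫ x ≫ D.prj i) ≫ (D.inc i ≫ w) = c • (D.inc i ≫ w) := by
    by_cases h : D.inc i ≫ w = 0
    · rw [h, comp_zero, smul_zero]
    · have := D.hom_simple _ h
      subst this
      obtain ⟨c', hc'⟩ := D.hom_simple_self (D.inc i ≫ w)
      rw [hc', Linear.comp_smul, hc, smul_comm]
  rw [Preadditive.sub_comp, sub_eq_zero]
  simp only [Category.assoc, Linear.smul_comp] at this ⊢
  rw [this, Linear.comp_smul]

end Setup

end Cat1
section Cat2

set_option linter.unusedSectionVars false

open Module

/-- right exactness of quotients gives subadditivity of dimensions -/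
lemma finrank_quot_le {K A B C' : Type*} [Field K] [AddCommGroup A] [Module K A]
    [AddCommGroup B] [Module K B] [AddCommGroup C'] [Module K C']
    [FiniteDimensional K A] [FiniteDimensional K B] [FiniteDimensional K C']
    (f : A →ₗ[K] B) (g : B →ₗ[K] C') (JA : Submodule K A) (JB : Submodule K B)
    (JC : Submodule K C') (hA : ∀ a ∈ JA, f a ∈ JB) (hB : ∀ b ∈ JB, g b ∈ JC)
    (hC : ∀ c ∈ JC, ∃ b ∈ JB, g b = c) (hex : ∀ b, g b = 0 → ∃ a, f a = b) :
    finrank K (B ⧸ JB) ≤ finrank K (A ⧸ JA) + finrank K (C' ⧸ JC) := by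
  let F := JA.mapQ JB f hA
  let Gm := JB.mapQ JC g hB
  have h1 := LinearMap.finrank_range_add_finrank_ker Gm
  have h2 : LinearMap.ker Gm ≤ LinearMap.range F := by
    intro x hx
    obtain ⟨b, rfl⟩ := JB.mkQ_surjective x
    have hx' : JC.mkQ (g b) = 0 := hx
    rw [Submodule.mkQ_apply, Submodule.Quotient.mk_eq_zero] at hx'
    obtain ⟨b', hb', hgb⟩ := hC _ hx'
    obtain ⟨a, ha⟩ := hex (b - b') (by rw [map_sub, hgb, sub_self])
    refine ⟨JA.mkQ a, ?_⟩
    have : F (JA.mkQ a) = JB.mkQ (f a) := rfl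
    rw [this, ha, map_sub]
    have h0 : JB.mkQ b' = 0 := by
      rw [Submodule.mkQ_apply, Submodule.Quotient.mk_eq_zero]; exact hb'
    rw [h0, sub_zero]
  have h3 := Submodule.finrank_mono h2
  have h4 := LinearMap.finrank_range_le F
  have h5 := Submodule.finrank_le (LinearMap.range Gm)
  omega

namespace Setup

variable (D : Setup k C n)

/-- morphisms factoring through sums of `Q t`, `t ≥ m` -/
def HJ (m : ℕ) (Y X : C) : Submodule k (Y ⟶ X) :=
  Submodule.span k {h | ∃ t : Fin n, m ≤ t ∧ ∃ (f : Y ⟶ D.Q t) (g : D.Q t ⟶ X), h = f ≫ g}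

lemma HJ_mem {m : ℕ} {Y X : C} {t : Fin n} (ht : m ≤ t) (f : Y ⟶ D.Q t) (g : D.Q t ⟶ X) :
    f ≫ g ∈ D.HJ m Y X := Submodule.subset_span ⟨t, ht, f, g, rfl⟩

lemma HJ_comp_left {m : ℕ} {Y' Y X : C} (a : Y' ⟶ Y) {h : Y ⟶ X} (hh : h ∈ D.HJ m Y X) :
    a ≫ h ∈ D.HJ m Y' X := by
  unfold HJ at hh
  induction hh using Submodule.span_induction with
  | mem x hx =>
    obtain ⟨t, ht, f, g, rfl⟩ := hx
    rw [← Category.assoc]; exact D.HJ_mem ht _ _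
  | zero => rw [comp_zero]; exact Submodule.zero_mem _
  | add x y _ _ hx hy => rw [Preadditive.comp_add]; exact Submodule.add_mem _ hx hy
  | smul c x _ hx => rw [Linear.comp_smul]; exact Submodule.smul_mem _ _ hx

lemma HJ_comp_right {m : ℕ} {Y X X' : C} (a : X ⟶ X') {h : Y ⟶ X} (hh : h ∈ D.HJ m Y X) :
    h ≫ a ∈ D.HJ m Y X' := by
  unfold HJ at hh
  induction hh using Submodule.span_induction with
  | mem x hx =>
    obtain ⟨t, ht, f, g, rfl⟩ := hx
    rw [Category.assoc]; exact D.HJ_mem ht _ _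
  | zero => rw [zero_comp]; exact Submodule.zero_mem _
  | add x y _ _ hx hy => rw [Preadditive.add_comp]; exact Submodule.add_mem _ hx hy
  | smul c x _ hx => rw [Linear.smul_comp]; exact Submodule.smul_mem _ _ hx

lemma HJ_lift {m : ℕ} {Y X X' : C} (p : X ⟶ X') [Epi p] {h : Y ⟶ X'} (hh : h ∈ D.HJ m Y X') :
    ∃ b ∈ D.HJ m Y X, b ≫ p = h := by
  have := D.projQ
  unfold HJ at hh
  induction hh using Submodule.span_induction with
  | mem x hx =>
    obtain ⟨t, ht, f, g, rfl⟩ := hx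
    refine ⟨f ≫ Projective.factorThru g p, D.HJ_mem ht _ _, ?_⟩
    rw [Category.assoc, Projective.factorThru_comp]
  | zero => exact ⟨0, Submodule.zero_mem _, zero_comp⟩
  | add x y _ _ hx hy =>
    obtain ⟨b, hb, rfl⟩ := hx
    obtain ⟨b', hb', rfl⟩ := hy
    exact ⟨b + b', Submodule.add_mem _ hb hb', Preadditive.add_comp _ _ _ _ _ _⟩
  | smul c x _ hx =>
    obtain ⟨b, hb, rfl⟩ := hx
    exact ⟨c • b, Submodule.smul_mem _ _ hb, Linear.smul_comp _ _ _ _ _ _⟩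

lemma HJ_kill {m : ℕ} {Y X V : C} {g : Y ⟶ X} (hg : g ∈ D.HJ m Y X) (v : X ⟶ V)
    (hV : D.Van m V) : g ≫ v = 0 := by
  unfold HJ at hg
  induction hg using Submodule.span_induction with
  | mem x hx =>
    obtain ⟨t, ht, f, g, rfl⟩ := hx
    rw [Category.assoc, hV t ht (g ≫ v), comp_zero]
  | zero => rw [zero_comp]
  | add x y _ _ hx hy => rw [Preadditive.add_comp, hx, hy, add_zero]
  | smul c x _ hx => rw [Linear.smul_comp, hx, smul_zero]

/-- the embedding of Homs into `End G` -/
def Phi {Y X : C} (rY : D.G ⟶ Y) (iX : X ⟶ D.G) : (Y ⟶ X) →ₗ[k] End D.G :=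
  Linear.leftComp k D.G rY ∘ₗ Linear.rightComp k Y iX

lemma Phi_apply {Y X : C} (rY : D.G ⟶ Y) (iX : X ⟶ D.G) (h : Y ⟶ X) :
    D.Phi rY iX h = (rY ≫ (h ≫ iX) : D.G ⟶ D.G) := rfl

lemma range_sand {Y X : C} {iY : Y ⟶ D.G} {rY : D.G ⟶ Y} (hY : iY ≫ rY = 𝟙 Y)
    {iX : X ⟶ D.G} {rX : D.G ⟶ X} (hX : iX ≫ rX = 𝟙 X) (eX eY : End D.G)
    (heX : eX = rX ≫ iX) (heY : eY = rY ≫ iY) :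
    LinearMap.range (sand k eX eY) = LinearMap.range (D.Phi rY iX) := by
  subst heX heY
  apply le_antisymm
  · rintro _ ⟨x, rfl⟩
    refine ⟨iY ≫ (show D.G ⟶ D.G from x) ≫ rX, ?_⟩
    rw [Phi_apply, sand_apply]
    show _ = ((rY ≫ iY) ≫ x) ≫ (rX ≫ iX)
    simp only [Category.assoc]
  · rintro _ ⟨h, rfl⟩
    refine ⟨D.Phi rY iX h, ?_⟩
    rw [Phi_apply, sand_apply]
    show ((rY ≫ iY) ≫ (rY ≫ (h ≫ iX))) ≫ (rX ≫ iX) = _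
    have h1 : iY ≫ rY ≫ h ≫ iX ≫ rX ≫ iX = h ≫ iX := by
      rw [← Category.assoc, hY, Category.id_comp, ← Category.assoc iX, hX, Category.id_comp]
    simp only [Category.assoc]
    rw [h1]

lemma Phi_mem {m : ℕ} {Y X : C} {iY : Y ⟶ D.G} {rY : D.G ⟶ Y} (hY : iY ≫ rY = 𝟙 Y)
    {iX : X ⟶ D.G} {rX : D.G ⟶ X} (hX : iX ≫ rX = 𝟙 X) (h : Y ⟶ X) :
    D.Phi rY iX h ∈ TI k D.e (Up n m) ↔ h ∈ D.HJ m Y X := by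
  constructor
  · intro hh
    have key : ∀ x : End D.G, x ∈ TI k D.e (Up n m) →
        iY ≫ (show D.G ⟶ D.G from x) ≫ rX ∈ D.HJ m Y X := by
      intro x hx
      unfold TI at hx
      induction hx using Submodule.span_induction with
      | mem x hx =>
        obtain ⟨a, t, b, ht, rfl⟩ := hx
        show iY ≫ ((show D.G ⟶ D.G from b) ≫ (D.prj t ≫ D.inc t) ≫ (show D.G ⟶ D.G from a)) ≫ rX
          ∈ D.HJ m Y X
        have := D.HJ_mem (m := m) (show m ≤ t.val from ht)
          (iY ≫ (show D.G ⟶ D.G from b) ≫ D.prj t) (D.inc t ≫ (show D.G ⟶ D.G from a) ≫ rX)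
        simpa only [Category.assoc] using this
      | zero =>
        show iY ≫ (0 : D.G ⟶ D.G) ≫ rX ∈ _
        rw [zero_comp, comp_zero]; exact Submodule.zero_mem _
      | add x y _ _ hx hy =>
        show iY ≫ ((show D.G ⟶ D.G from x) + (show D.G ⟶ D.G from y)) ≫ rX ∈ _
        rw [Preadditive.add_comp, Preadditive.comp_add]; exact Submodule.add_mem _ hx hy
      | smul c x _ hx =>
        show iY ≫ (c • (show D.G ⟶ D.G from x)) ≫ rX ∈ _
        rw [Linear.smul_comp, Linear.comp_smul]; exact Submodule.smul_mem _ _ hx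
    have h2 := key _ hh
    rw [Phi_apply] at h2
    have h3 : iY ≫ (rY ≫ (h ≫ iX)) ≫ rX = h := by
      rw [Category.assoc, Category.assoc, hX, Category.comp_id, ← Category.assoc, hY,
        Category.id_comp]
    rw [← h3]; exact h2
  · intro hh
    unfold HJ at hh
    induction hh using Submodule.span_induction with
    | mem x hx =>
      obtain ⟨t, ht, f, g, rfl⟩ := hx
      have := TI_mem (K := k) D.e (E := Up n m) (t := t) ht
        (show End D.G from D.prj t ≫ g ≫ iX) (show End D.G from rY ≫ f ≫ D.inc t)
      convert this using 1
      show rY ≫ ((f ≫ g) ≫ iX) = (rY ≫ f ≫ D.inc t) ≫ (D.prj t ≫ D.inc t) ≫ (D.prj t ≫ g ≫ iX)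
      have h1 : D.inc t ≫ D.prj t ≫ D.inc t ≫ D.prj t ≫ g ≫ iX = g ≫ iX := by
        rw [← Category.assoc, D.inc_prj, Category.id_comp, ← Category.assoc, D.inc_prj,
          Category.id_comp]
      simp only [Category.assoc]
      rw [h1]
    | zero => rw [map_zero]; exact Submodule.zero_mem _
    | add x y _ _ hx hy => rw [map_add]; exact Submodule.add_mem _ hx hy
    | smul c x _ hx => rw [map_smul]; exact Submodule.smul_mem _ _ hx

lemma pd_hom (m : ℕ) {Y X : C} {iY : Y ⟶ D.G} {rY : D.G ⟶ Y} (hY : iY ≫ rY = 𝟙 Y)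
    {iX : X ⟶ D.G} {rX : D.G ⟶ X} (hX : iX ≫ rX = 𝟙 X) (eX eY : End D.G)
    (heX : eX = rX ≫ iX) (heY : eY = rY ≫ iY) :
    pd k (TI k D.e (Up n m)) eX eY = finrank k ((Y ⟶ X) ⧸ D.HJ m Y X) := by
  unfold pd
  rw [D.range_sand hY hX eX eY heX heY, ← LinearMap.range_comp]
  have hker : LinearMap.ker ((TI k D.e (Up n m)).mkQ ∘ₗ D.Phi rY iX) = D.HJ m Y X := by
    ext h
    rw [LinearMap.mem_ker, LinearMap.comp_apply, Submodule.mkQ_apply,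
      Submodule.Quotient.mk_eq_zero]
    exact D.Phi_mem hY hX h
  rw [← hker]
  exact (LinearEquiv.finrank_eq (LinearMap.quotKerEquivRange _)).symm

lemma finrank_sand {X : C} {iX : X ⟶ D.G} {rX : D.G ⟶ X} (hX : iX ≫ rX = 𝟙 X) (eX : End D.G)
    (heX : eX = rX ≫ iX) :
    finrank k (LinearMap.range (sand k eX (1 : End D.G))) = finrank k (D.G ⟶ X) := by
  rw [D.range_sand (Category.id_comp (𝟙 D.G)) hX eX 1 heX (Category.id_comp (𝟙 D.G)).symm]
  apply LinearMap.finrank_range_of_inj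
  intro x y hxy
  rw [Phi_apply, Phi_apply, Category.id_comp, Category.id_comp] at hxy
  rw [← Category.comp_id x, ← Category.comp_id y, ← hX, ← Category.assoc, ← Category.assoc]
  exact congrArg (fun z : D.G ⟶ D.G => z ≫ rX) hxy

/-- `v : X ⟶ V` is the maximal quotient without composition factors `S t`, `t ≥ m`. -/
structure IsV (m : ℕ) (X V : C) (v : X ⟶ V) : Prop where
  epi : Epi v
  van : D.Van m V
  ker : ∀ Y : C, Projective Y → ∀ g : Y ⟶ X, g ≫ v = 0 → g ∈ D.HJ m Y X

lemma exists_V (m : ℕ) (X : C) : ∃ (V : C) (v : X ⟶ V), D.IsV m X V v := by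
  have := D.projQ
  have := D.homFinite
  let ι := Σ t : {t : Fin n // m ≤ t.val}, Fin (finrank k (D.Q t.1 ⟶ X))
  let b : ∀ i : ι, D.Q i.1.1 ⟶ X := fun i => finBasis k (D.Q i.1.1 ⟶ X) i.2
  let d : (⨁ fun i : ι => D.Q i.1.1) ⟶ X := biproduct.desc b
  refine ⟨cokernel d, cokernel.π d, inferInstance, ?_, ?_⟩
  · intro t ht f
    have hz : ∀ f' : D.Q t ⟶ X, f' ≫ cokernel.π d = 0 := by
      intro f'
      rw [← (finBasis k (D.Q t ⟶ X)).sum_repr f', Preadditive.sum_comp]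
      apply Finset.sum_eq_zero
      intro c _
      have h1 : finBasis k (D.Q t ⟶ X) c
          = biproduct.ι (fun i : ι => D.Q i.1.1) ⟨⟨t, ht⟩, c⟩ ≫ d := by
        simp only [d, biproduct.ι_desc]; rfl
      rw [Linear.smul_comp, h1, Category.assoc, cokernel.condition, comp_zero, smul_zero]
    rw [← Projective.factorThru_comp f (cokernel.π d), hz]
  · intro Y hY g hg
    have hex := ShortComplex.exact_cokernel d
    have h1 := hex.liftFromProjective_comp g hg
    rw [← h1]
    show hex.liftFromProjective g hg ≫ d ∈ _
    generalize hex.liftFromProjective g hg = l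
    dsimp at l
    have h2 : l ≫ d = ∑ i : ι, (l ≫ biproduct.π _ i) ≫ b i := by
      conv_lhs => rw [← Category.comp_id l, ← biproduct.total, Preadditive.comp_sum,
        Preadditive.sum_comp]
      simp [d]
    rw [h2]
    exact Submodule.sum_mem _ fun i _ => D.HJ_mem i.1.2 _ _

variable {D}

lemma IsV.desc {m : ℕ} {X V W : C} {v : X ⟶ V} (h : D.IsV m X V v) (w : X ⟶ W)
    (hW : D.Van m W) : ∃ r : V ⟶ W, v ≫ r = w := by
  have := h.epi
  have h0 : kernel.ι v ≫ w = 0 := by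
    apply D.sep
    intro g
    rw [← Category.assoc]
    apply D.HJ_kill (m := m) _ _ hW
    apply h.ker _ D.projG
    rw [Category.assoc, kernel.condition, comp_zero]
  exact ⟨Abelian.epiDesc v w h0, Abelian.comp_epiDesc _ _ _⟩

lemma IsV.ker_iff {m : ℕ} {X V : C} {v : X ⟶ V} (h : D.IsV m X V v) (Y : C)
    (hY : Projective Y) (g : Y ⟶ X) : g ≫ v = 0 ↔ g ∈ D.HJ m Y X :=
  ⟨h.ker Y hY g, fun hg => D.HJ_kill hg v h.van⟩

lemma IsV.finrank {m : ℕ} {X V : C} {v : X ⟶ V} (h : D.IsV m X V v) (Y : C)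
    (hY : Projective Y) : finrank k (Y ⟶ V) = finrank k ((Y ⟶ X) ⧸ D.HJ m Y X) := by
  have := h.epi
  have hker : LinearMap.ker (Linear.rightComp k Y v) = D.HJ m Y X := by
    ext g
    rw [LinearMap.mem_ker]
    exact h.ker_iff Y hY g
  rw [← hker]
  refine (LinearEquiv.finrank_eq (LinearMap.quotKerEquivOfSurjective _ ?_)).symm
  intro g
  exact ⟨Projective.factorThru g v, Projective.factorThru_comp g v⟩

lemma IsV.of_max {s : Fin n} {Δ : C} {q : D.Q s ⟶ Δ}
    (h : IsMaxQuotientIn (ExtClosure (fun X => ∃ j, j ≤ s ∧ Nonempty (X ≅ D.S j))) (D.Q s) Δ q) :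
    D.IsV (s + 1) (D.Q s) Δ q := by
  obtain ⟨V, v, hV⟩ := D.exists_V (s + 1) (D.Q s)
  obtain ⟨r, hr⟩ := h.2.2 v hV.epi (D.van_serre hV.van)
  refine ⟨h.1, D.serre_van h.2.1, fun Y hY g hg => hV.ker Y hY g ?_⟩
  rw [← hr, ← Category.assoc, hg, zero_comp]

lemma IsV.max {s : Fin n} {Δ : C} {q : D.Q s ⟶ Δ} (h : D.IsV (s + 1) (D.Q s) Δ q) :
    IsMaxQuotientIn (ExtClosure (fun X => ∃ j, j ≤ s ∧ Nonempty (X ≅ D.S j))) (D.Q s) Δ q :=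
  ⟨h.epi, D.van_serre h.van, fun _ e _ hE => h.desc e (D.serre_van hE)⟩

lemma IsV.finrank_end {s : Fin n} {Δ : C} {q : D.Q s ⟶ Δ} (h : D.IsV (s + 1) (D.Q s) Δ q) :
    Module.finrank k (End Δ) = Module.finrank k (D.Q s ⟶ Δ) := by
  have := h.epi
  refine LinearEquiv.finrank_eq (LinearEquiv.ofBijective (Linear.leftComp k Δ q) ⟨?_, ?_⟩)
  · intro x y hxy
    exact (cancel_epi q).1 hxy
  · intro w
    exact h.desc w h.van

end Setup

end Cat2
section Cat3

set_option linter.unusedSectionVars false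

open Module

namespace Setup

variable (D : Setup k C n)

/-- the multiplicity of `Δ s` in `X` -/
noncomputable def am (s : Fin n) (X : C) : ℕ :=
  finrank k ((D.Q s ⟶ X) ⧸ D.HJ (s + 1) (D.Q s) X)

lemma am_sub (s : Fin n) (T : ShortComplex C) (hT : T.ShortExact) :
    D.am s T.X₂ ≤ D.am s T.X₁ + D.am s T.X₃ := by
  have := D.homFinite
  have := D.projQ
  have := hT.epi_g
  refine finrank_quot_le (Linear.rightComp k _ T.f) (Linear.rightComp k _ T.g) _ _ _ ?_ ?_ ?_ ?_
  · intro a ha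
    exact D.HJ_comp_right _ ha
  · intro a ha
    exact D.HJ_comp_right _ ha
  · intro c hc
    exact D.HJ_lift T.g hc
  · intro b hb
    exact ⟨hT.exact.liftFromProjective b hb, hT.exact.liftFromProjective_comp b hb⟩

lemma am_epi (s : Fin n) {X X' : C} (f : X ⟶ X') [Epi f] : D.am s X' ≤ D.am s X := by
  have := D.homFinite
  have := D.projQ
  refine LinearMap.finrank_le_finrank_of_surjective
    (f := (D.HJ (s + 1) (D.Q s) X).mapQ (D.HJ (s + 1) (D.Q s) X') (Linear.rightComp k _ f)
      (fun a ha => D.HJ_comp_right _ ha)) ?_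
  intro x
  obtain ⟨x, rfl⟩ := Submodule.mkQ_surjective _ x
  refine ⟨Submodule.mkQ _ (Projective.factorThru x f), ?_⟩
  exact congrArg (Submodule.mkQ _) (Projective.factorThru_comp x f)

lemma am_zero (s : Fin n) {X : C} (h : ∀ f : D.Q s ⟶ X, f ∈ D.HJ (s + 1) (D.Q s) X) :
    D.am s X = 0 := by
  have : D.HJ (s + 1) (D.Q s) X = ⊤ := by
    rw [eq_top_iff]; exact fun f _ => h f
  unfold am
  rw [this]
  exact finrank_zero_of_subsingleton

lemma finrank_mono {X X' : C} (f : X ⟶ X') [Mono f] :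
    finrank k (D.G ⟶ X) ≤ finrank k (D.G ⟶ X') := by
  have := D.homFinite
  refine LinearMap.finrank_le_finrank_of_injective (f := Linear.rightComp k D.G f) ?_
  intro x y hxy
  exact (cancel_mono f).1 hxy

lemma finrank_add (T : ShortComplex C) (hT : T.ShortExact) :
    finrank k (D.G ⟶ T.X₁) + finrank k (D.G ⟶ T.X₃) ≤ finrank k (D.G ⟶ T.X₂) := by
  have := D.homFinite
  have := D.projG
  have := hT.epi_g
  have := hT.mono_f
  have h1 := LinearMap.finrank_range_add_finrank_ker (Linear.rightComp k D.G T.g)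
  have h2 : LinearMap.range (Linear.rightComp k D.G T.g) = ⊤ := by
    rw [LinearMap.range_eq_top]
    intro x
    exact ⟨Projective.factorThru x T.g, Projective.factorThru_comp x T.g⟩
  have h3 : LinearMap.range (Linear.rightComp k D.G T.f) ≤
      LinearMap.ker (Linear.rightComp k D.G T.g) := by
    rintro _ ⟨x, rfl⟩
    rw [LinearMap.mem_ker]
    show (x ≫ T.f) ≫ T.g = 0
    rw [Category.assoc, T.zero, comp_zero]
  have h4 := Submodule.finrank_mono h3
  have h5 : finrank k (LinearMap.range (Linear.rightComp k D.G T.f)) = finrank k (D.G ⟶ T.X₁) := by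
    apply LinearMap.finrank_range_of_inj
    intro x y hxy
    exact (cancel_mono T.f).1 hxy
  rw [h2, finrank_top] at h1
  omega

lemma am_G (s : Fin n) : D.am s D.G ≤ ∑ l, D.am s (D.Q l) := by
  have := D.homFinite
  let F : (D.Q s ⟶ D.G) →ₗ[k] (∀ l, (D.Q s ⟶ D.Q l) ⧸ D.HJ (s + 1) (D.Q s) (D.Q l)) :=
    LinearMap.pi fun l => Submodule.mkQ _ ∘ₗ Linear.rightComp k _ (D.prj l)
  have hker : LinearMap.ker F = D.HJ (s + 1) (D.Q s) D.G := by
    ext x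
    rw [LinearMap.mem_ker]
    constructor
    · intro h
      rw [D.decomp' x]
      refine Submodule.sum_mem _ fun l _ => D.HJ_comp_right _ ?_
      have h1 := congrFun h l
      exact (Submodule.Quotient.mk_eq_zero _).1 h1
    · intro h
      funext l
      exact (Submodule.Quotient.mk_eq_zero _).2 (D.HJ_comp_right (D.prj l) h)
  unfold am
  rw [← finrank_pi_fintype, ← hker]
  rw [LinearEquiv.finrank_eq (LinearMap.quotKerEquivRange F)]
  exact Submodule.finrank_le _

lemma finrank_G : ∑ l, finrank k (D.G ⟶ D.Q l) ≤ finrank k (End D.G) := by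
  have := D.homFinite
  have := D.finEnd
  rw [← finrank_pi_fintype]
  let F : (End D.G) →ₗ[k] (∀ l, (D.G ⟶ D.Q l)) :=
    LinearMap.pi fun l => Linear.rightComp k _ (D.prj l)
  refine LinearMap.finrank_le_finrank_of_surjective (f := F) ?_
  intro w
  refine ⟨(∑ l, w l ≫ D.inc l : D.G ⟶ D.G), ?_⟩
  funext j
  show (∑ l, w l ≫ D.inc l) ≫ D.prj j = w j
  rw [Preadditive.sum_comp, Finset.sum_eq_single j]
  · rw [Category.assoc, D.inc_prj, Category.comp_id]
  · intro l _ hl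
    rw [Category.assoc, D.inc_prj_ne l j hl, comp_zero]
  · simp

theorem N_of_hw (Δ : Fin n → C) (q : ∀ i, D.Q i ⟶ Δ i)
    (hmax : ∀ i, IsMaxQuotientIn (ExtClosure (fun X => ∃ j, j ≤ i ∧ Nonempty (X ≅ D.S j)))
      (D.Q i) (Δ i) (q i))
    (hend : ∀ i, Nonempty (End (Δ i) ≃ₐ[k] k))
    (hext : ∀ i, ExtClosure (fun X => ∃ j, i ≤ j ∧ Nonempty (X ≅ Δ j)) (D.Q i)) :
    N1 k D.e ∧ N2 k D.e 1 := by
  have := D.homFinite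
  have hprojQ := D.projQ
  have hV : ∀ s : Fin n, D.IsV (s + 1) (D.Q s) (Δ s) (q s) := fun s => IsV.of_max (hmax s)
  have h1 : ∀ s, finrank k (D.Q s ⟶ Δ s) = 1 := by
    intro s
    rw [← (hV s).finrank_end, LinearEquiv.finrank_eq (hend s).some.toLinearEquiv, finrank_self]
  constructor
  · intro s
    rw [D.pd_hom (s + 1) (D.inc_prj s) (D.inc_prj s) (D.e s) (D.e s) rfl rfl,
      ← (hV s).finrank _ (D.projQ s), h1]
  have hne : ∀ s j, s ≠ j → D.am s (Δ j) = 0 := by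
    intro s j hsj
    apply D.am_zero
    intro f
    rcases lt_or_gt_of_ne hsj with h | h
    · have := (hV j).epi
      rw [← Projective.factorThru_comp f (q j)]
      exact D.HJ_mem (by rw [Fin.lt_def] at h; omega) _ _
    · rw [(hV j).van s (by rw [Fin.lt_def] at h; omega) f]
      exact Submodule.zero_mem _
  have hself : ∀ s, D.am s (Δ s) ≤ 1 := by
    intro s
    rw [← h1 s]
    exact Submodule.finrank_quotient_le _
  have hX : ∀ i X, ExtClosure (fun X => ∃ j, i ≤ j ∧ Nonempty (X ≅ Δ j)) X →
      ∑ s, D.am s X * finrank k (D.G ⟶ Δ s) ≤ finrank k (D.G ⟶ X) := by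
    intro i X hX
    induction hX with
    | of X h =>
      obtain ⟨j, _, ⟨a⟩⟩ := h
      rw [Finset.sum_eq_single j]
      · calc _ ≤ 1 * finrank k (D.G ⟶ Δ j) :=
              Nat.mul_le_mul_right _ ((D.am_epi j a.inv).trans (hself j))
          _ ≤ _ := by rw [one_mul]; exact D.finrank_mono a.inv
      · intro s _ hs
        have := D.am_epi s a.inv
        rw [hne s j hs] at this
        rw [Nat.le_zero.1 this, zero_mul]
      · simp
    | zero X h =>
      rw [Finset.sum_eq_zero]
      · exact Nat.zero_le _
      · intro s _
        rw [D.am_zero s (fun f => by rw [h.eq_of_tgt f 0]; exact Submodule.zero_mem _), zero_mul]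
    | ext T hT _ _ ih1 ih3 =>
      refine le_trans ?_ (D.finrank_add T hT)
      refine le_trans ?_ (add_le_add ih1 ih3)
      rw [← Finset.sum_add_distrib]
      refine Finset.sum_le_sum fun s _ => ?_
      rw [← add_mul]
      exact Nat.mul_le_mul_right _ (D.am_sub s T hT)
  unfold N2
  have hid := Category.id_comp (𝟙 D.G)
  have hone : (1 : End D.G) = 𝟙 D.G ≫ 𝟙 D.G := hid.symm
  rw [D.finrank_sand hid 1 hone]
  refine le_trans ?_ D.finrank_G
  refine le_trans ?_ (Finset.sum_le_sum fun l _ => hX l _ (hext l))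
  rw [Finset.sum_comm]
  refine Finset.sum_le_sum fun s _ => ?_
  rw [← Finset.sum_mul]
  rw [D.pd_hom (s + 1) (D.inc_prj s) hid 1 (D.e s) hone rfl,
    D.pd_hom (s + 1) hid (D.inc_prj s) (D.e s) 1 rfl hone,
    ← (hV s).finrank _ D.projG]
  exact Nat.mul_le_mul_right _ (D.am_G s)

end Setup

end Cat3
section Cat4

set_option linter.unusedSectionVars false

open Module
open scoped ZeroObject

lemma telescope {n : ℕ} (f : ℕ → ℕ) (c : Fin n → ℕ) (h0 : f 0 = 0)
    (h : ∀ s : Fin n, f (s + 1) ≤ c s + f s) (hs : ∑ s, c s ≤ f n) (s : Fin n) :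
    c s + f s ≤ f (s + 1) := by
  have h1 : ∑ s : Fin n, ((f (s + 1) : ℤ) - f s) = f n := by
    rw [Fin.sum_univ_eq_sum_range (fun i => (f (i + 1) : ℤ) - f i) n,
      Finset.sum_range_sub (fun i => (f i : ℤ)), h0]
    simp
  have h2 : ∑ s : Fin n, ((c s : ℤ) - (f (s + 1) - f s)) ≤ 0 := by
    rw [Finset.sum_sub_distrib, h1]
    have : ((∑ s, c s : ℕ) : ℤ) ≤ f n := by exact_mod_cast hs
    push_cast at this
    linarith
  have h3 : ∀ s ∈ (Finset.univ : Finset (Fin n)), (0 : ℤ) ≤ (c s : ℤ) - (f (s + 1) - f s) := by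
    intro s _
    have := h s
    omega
  have h4 := Finset.single_le_sum h3 (Finset.mem_univ s)
  omega

lemma ExtClosure.iso {P : C → Prop} {X Y : C} (h : ExtClosure P X) (a : X ≅ Y) :
    ExtClosure P Y := by
  have hT : (ShortComplex.mk a.hom (0 : Y ⟶ 0) comp_zero).ShortExact := by
    refine { exact := ?_, mono_f := ?_, epi_g := ?_ }
    · rw [ShortComplex.exact_iff_epi _ rfl]
      dsimp; infer_instance
    · dsimp; infer_instance
    · exact (isZero_zero C).epi _
  exact ExtClosure.ext _ hT h (ExtClosure.zero _ (isZero_zero C))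

lemma ExtClosure.biprod {P : C → Prop} {X : C} (h : P X) (d : ℕ) :
    ExtClosure P (⨁ fun _ : Fin d => X) := by
  induction d with
  | zero =>
    apply ExtClosure.zero
    rw [IsZero.iff_id_eq_zero]
    apply biproduct.hom_ext
    intro j
    exact j.elim0
  | succ d ih =>
    let T : ShortComplex C := ShortComplex.mk (biproduct.ι (fun _ : Fin (d + 1) => X) 0)
      (biproduct.lift fun i : Fin d => biproduct.π (fun _ : Fin (d + 1) => X) i.succ) (by
        apply biproduct.hom_ext
        intro j
        rw [Category.assoc, biproduct.lift_π, zero_comp]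
        exact biproduct.ι_π_ne _ (Fin.succ_ne_zero j).symm)
    have hs : T.Splitting :=
      { r := biproduct.π (fun _ : Fin (d + 1) => X) 0
        s := biproduct.desc fun i : Fin d => biproduct.ι (fun _ : Fin (d + 1) => X) i.succ
        f_r := biproduct.ι_π_self _ _
        s_g := by
          apply biproduct.hom_ext'
          intro i
          apply biproduct.hom_ext
          intro j
          simp only [T, Category.assoc, biproduct.lift_π, biproduct.ι_desc_assoc, Category.comp_id]
          rw [biproduct.ι_π, biproduct.ι_π]
          by_cases hij : i = j
          · subst hij; simp
          · rw [dif_neg hij, dif_neg (fun h => hij (Fin.succ_injective _ h))]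
        id := by
          simp only [T, biproduct.lift_desc]
          rw [← biproduct.total, Fin.sum_univ_succ] }
    exact ExtClosure.ext T hs.shortExact (ExtClosure.of _ h) ih

namespace Setup

variable (D : Setup k C n)

lemma van_zero {V : C} (h : D.Van 0 V) : IsZero V := by
  apply D.isZero_of_sep
  intro g
  rw [D.decomp g]
  apply Finset.sum_eq_zero
  intro i _
  rw [h i (Nat.zero_le _) (D.inc i ≫ g), comp_zero]

lemma HJ_last (Y X : C) : D.HJ n Y X = ⊥ := by
  rw [eq_bot_iff]
  unfold HJ
  rw [Submodule.span_le]
  rintro _ ⟨t, ht, _⟩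
  exact absurd t.2 (not_lt.2 ht)

lemma step_exists (s : Fin n) {Δ : C} {q : D.Q s ⟶ Δ} (hq : D.IsV (s + 1) (D.Q s) Δ q)
    {X A B : C} {a : X ⟶ A} {b : X ⟶ B} (hA : D.IsV (s + 1) X A a) (hB : D.IsV s X B b) :
    ∃ (u : A ⟶ B) (φ : (⨁ fun _ : Fin (finrank k (D.Q s ⟶ A)) => Δ) ⟶ A),
      Epi u ∧ φ ≫ u = 0 ∧ ∀ g : D.G ⟶ A, g ≫ u = 0 → ∃ y, y ≫ φ = g := by
  have := D.homFinite
  have := D.projQ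
  have := D.projG
  have := hq.epi
  have := hA.epi
  have := hB.epi
  obtain ⟨u, hu⟩ := hA.desc b (hB.van.mono (Nat.le_succ _))
  choose ψ hψ using fun c => hq.desc (finBasis k (D.Q s ⟶ A) c) hA.van
  let φ : (⨁ fun _ : Fin (finrank k (D.Q s ⟶ A)) => Δ) ⟶ A := biproduct.desc ψ
  refine ⟨u, φ, ?_, ?_, ?_⟩
  · have : Epi (a ≫ u) := by rw [hu]; infer_instance
    exact epi_of_epi a u
  · apply biproduct.hom_ext'
    intro c
    rw [← cancel_epi q]
    simp only [φ, biproduct.ι_desc_assoc, comp_zero]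
    exact hB.van s le_rfl _
  · have key : ∀ h ∈ D.HJ s D.G X, ∃ y, y ≫ φ = h ≫ a := by
      intro h hh
      unfold HJ at hh
      induction hh using Submodule.span_induction with
      | mem x hx =>
        obtain ⟨t, ht, f, g, rfl⟩ := hx
        by_cases hts : t = s
        · subst hts
          refine ⟨f ≫ q ≫ ∑ c, (finBasis k (D.Q t ⟶ A)).repr (g ≫ a) c •
            biproduct.ι (fun _ : Fin (finrank k (D.Q t ⟶ A)) => Δ) c, ?_⟩
          rw [Category.assoc, Category.assoc, Category.assoc]
          congr 1
          conv_rhs => rw [← (finBasis k (D.Q t ⟶ A)).sum_repr (g ≫ a)]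
          rw [Preadditive.sum_comp, Preadditive.comp_sum]
          refine Finset.sum_congr rfl fun c _ => ?_
          rw [Linear.smul_comp, Linear.comp_smul]
          simp only [φ, biproduct.ι_desc]
          rw [hψ]
        · have : g ≫ a = 0 := hA.van t (by
            have : t.val ≠ s.val := fun h => hts (Fin.ext h)
            omega) _
          exact ⟨0, by rw [zero_comp, Category.assoc, this, comp_zero]⟩
      | zero => exact ⟨0, by rw [zero_comp, zero_comp]⟩
      | add x y _ _ hx hy =>
        obtain ⟨x', hx⟩ := hx
        obtain ⟨y', hy⟩ := hy
        exact ⟨x' + y', by rw [Preadditive.add_comp, Preadditive.add_comp, hx, hy]⟩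
      | smul c x _ hx =>
        obtain ⟨x', hx⟩ := hx
        exact ⟨c • x', by rw [Linear.smul_comp, Linear.smul_comp, hx]⟩
    intro g hg
    have h1 : Projective.factorThru g a ≫ a = g := Projective.factorThru_comp g a
    obtain ⟨y, hy⟩ := key (Projective.factorThru g a) (hB.ker _ D.projG _ (by
      rw [← hu, ← Category.assoc, h1, hg]))
    exact ⟨y, by rw [hy, h1]⟩

lemma finrank_biprod (d : ℕ) (Δ : C) :
    finrank k (D.G ⟶ ⨁ fun _ : Fin d => Δ) ≤ d * finrank k (D.G ⟶ Δ) := by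
  have := D.homFinite
  have h1 : finrank k (Fin d → (D.G ⟶ Δ)) = d * finrank k (D.G ⟶ Δ) := by
    rw [finrank_pi_fintype]; simp
  rw [← h1]
  let F : (D.G ⟶ ⨁ fun _ : Fin d => Δ) →ₗ[k] (Fin d → (D.G ⟶ Δ)) :=
    LinearMap.pi fun i => Linear.rightComp k _ (biproduct.π (fun _ : Fin d => Δ) i)
  refine LinearMap.finrank_le_finrank_of_injective (f := F) ?_
  intro x y hxy
  apply biproduct.hom_ext
  intro j
  exact congrFun hxy j

lemma step_finrank {Z A B : C} (u : A ⟶ B) (φ : Z ⟶ A)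
    (hφ : ∀ g : D.G ⟶ A, g ≫ u = 0 → ∃ y, y ≫ φ = g) :
    finrank k (D.G ⟶ A) ≤ finrank k (D.G ⟶ Z) + finrank k (D.G ⟶ B) ∧
    (finrank k (D.G ⟶ Z) + finrank k (D.G ⟶ B) ≤ finrank k (D.G ⟶ A) → Mono φ) := by
  have := D.homFinite
  have h1 := LinearMap.finrank_range_add_finrank_ker (Linear.rightComp k D.G u)
  have h2 := LinearMap.finrank_range_add_finrank_ker (Linear.rightComp k D.G φ)
  have h3 : LinearMap.ker (Linear.rightComp k D.G u) ≤
      LinearMap.range (Linear.rightComp k D.G φ) := fun g hg => hφ g hg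
  have h4 := Submodule.finrank_mono h3
  have h5 := Submodule.finrank_le (LinearMap.range (Linear.rightComp k D.G u))
  refine ⟨by omega, fun h => ?_⟩
  have h6 : finrank k (LinearMap.ker (Linear.rightComp k D.G φ)) = 0 := by omega
  rw [Submodule.finrank_eq_zero] at h6
  apply D.mono_of_sep
  intro g hg
  have : g ∈ LinearMap.ker (Linear.rightComp k D.G φ) := hg
  rw [h6] at this
  exact this

lemma shortExact_of {Z A B : C} (u : A ⟶ B) (φ : Z ⟶ A) (h0 : φ ≫ u = 0) [Epi u] [Mono φ]
    (hφ : ∀ g : D.G ⟶ A, g ≫ u = 0 → ∃ y, y ≫ φ = g) :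
    (ShortComplex.mk φ u h0).ShortExact := by
  refine { exact := ?_ }
  rw [ShortComplex.exact_iff_kernel_ι_comp_cokernel_π_zero]
  apply D.sep
  intro g
  dsimp at g ⊢
  obtain ⟨y, hy⟩ := hφ (g ≫ kernel.ι u) (by rw [Category.assoc, kernel.condition, comp_zero])
  rw [← Category.assoc, ← hy, Category.assoc, cokernel.condition, comp_zero]

theorem hw_of_N (h1 : N1 k D.e) (h2 : ∀ a, N2 k D.e a) :
    ∃ (Δ : Fin n → C) (q : ∀ i, D.Q i ⟶ Δ i),
    (∀ i, IsMaxQuotientIn (ExtClosure (fun X => ∃ j, j ≤ i ∧ Nonempty (X ≅ D.S j)))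
      (D.Q i) (Δ i) (q i)) ∧
    ∀ i, Nonempty (End (Δ i) ≃ₐ[k] k) ∧
      ExtClosure (fun X => ∃ j, i ≤ j ∧ Nonempty (X ≅ Δ j)) (D.Q i) := by
  have hfin := D.homFinite
  choose V v hV using D.exists_V
  have hq : ∀ s : Fin n, D.IsV (s + 1) (D.Q s) (V (s + 1) (D.Q s)) (v (s + 1) (D.Q s)) :=
    fun s => hV _ _
  have hid := Category.id_comp (𝟙 D.G)
  have hone : (1 : End D.G) = 𝟙 D.G ≫ 𝟙 D.G := hid.symm
  refine ⟨fun s => V (s + 1) (D.Q s), fun s => v (s + 1) (D.Q s), fun s => (hq s).max, ?_⟩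
  intro l
  constructor
  · have hle : finrank k (End (V (l + 1) (D.Q l))) ≤ 1 := by
      rw [(hq l).finrank_end, (hq l).finrank _ (D.projQ l),
        ← D.pd_hom (l + 1) (D.inc_prj l) (D.inc_prj l) (D.e l) (D.e l) rfl rfl]
      exact h1 l
    have hS : D.Van (l + 1) (D.S l) := by
      intro t ht f
      by_contra hf
      have := D.hom_simple f hf
      subst this
      omega
    obtain ⟨r, hr⟩ := (hq l).desc (D.p l) hS
    have hnt : Nontrivial (End (V (l + 1) (D.Q l))) := by
      refine ⟨⟨1, 0, fun h => D.p_ne l ?_⟩⟩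
      have h' : 𝟙 (V (l + 1) (D.Q l)) = 0 := h
      rw [← hr, ← Category.id_comp r, h', zero_comp, comp_zero]
    have hf : FiniteDimensional k (End (V (l + 1) (D.Q l))) := hfin _ _
    have hpos : 0 < finrank k (End (V (l + 1) (D.Q l))) := finrank_pos
    have hb := Module.Free.bijective_algebraMap_of_finrank_eq_one (R := k)
      (S := End (V (l + 1) (D.Q l))) (by omega)
    exact ⟨(AlgEquiv.ofBijective (Algebra.ofId k _) hb).symm⟩
  · let X := D.Q l
    choose u φ hu hu0 hφ using fun s : Fin n => D.step_exists s (hq s) (hV (s + 1) X) (hV s X)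
    have hbp := fun s : Fin n => D.finrank_biprod (finrank k (D.Q s ⟶ V (s + 1) X))
      (V (s + 1) (D.Q s))
    have hst := fun s : Fin n => D.step_finrank (u s) (φ s) (hφ s)
    have htel := telescope (fun m => finrank k (D.G ⟶ V m X))
      (fun s => finrank k (D.Q s ⟶ V (s + 1) X) * finrank k (D.G ⟶ V (s + 1) (D.Q s))) (by
        have hz := D.van_zero (hV 0 X).van
        have : Subsingleton (D.G ⟶ V 0 X) := ⟨fun a b => hz.eq_of_tgt a b⟩
        exact finrank_zero_of_subsingleton) (by
        intro s
        have := (hst s).1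
        have := hbp s
        omega) (by
        have h3 := h2 (D.e l)
        unfold N2 at h3
        rw [D.finrank_sand (D.inc_prj l) (D.e l) rfl] at h3
        have h4 : finrank k (D.G ⟶ V n X) = finrank k (D.G ⟶ X) := by
          rw [(hV n X).finrank _ D.projG, D.HJ_last]
          exact LinearEquiv.finrank_eq (Submodule.quotEquivOfEqBot ⊥ rfl)
        rw [h4]
        refine le_trans (le_of_eq (Finset.sum_congr rfl fun s _ => ?_)) h3
        rw [D.pd_hom (s + 1) (D.inc_prj s) (D.inc_prj l) (D.e l) (D.e s) rfl rfl,
          D.pd_hom (s + 1) hid (D.inc_prj s) (D.e s) 1 rfl hone,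
          ← (hV (s + 1) X).finrank _ (D.projQ s), ← (hq s).finrank _ D.projG])
    have hind : ∀ d : ℕ, l + d ≤ n → ExtClosure (fun X => ∃ j : Fin n, l ≤ j ∧
        Nonempty (X ≅ V (j + 1) (D.Q j))) (V (l + d) X) := by
      intro d
      induction d with
      | zero =>
        intro _
        apply ExtClosure.zero
        have := (hV l X).epi
        rw [add_zero, IsZero.iff_id_eq_zero, ← cancel_epi (v l X),
          (hV l X).van l le_rfl (v l X), zero_comp, zero_comp]
      | succ d ih =>
        intro hd
        let s : Fin n := ⟨l + d, by omega⟩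
        have := hu s
        have : Mono (φ s) := (hst s).2 (by
          have := htel s
          have := hbp s
          omega)
        have hT := D.shortExact_of (u s) (φ s) (hu0 s) (hφ s)
        exact ExtClosure.ext _ hT
          (ExtClosure.biprod ⟨s, by rw [Fin.le_def]; simp [s], ⟨Iso.refl _⟩⟩ _) (ih (by omega))
    have h5 := hind (n - l) (by omega)
    have h6 : l + (n - l) = n := by omega
    rw [h6] at h5
    have := (hV n X).epi
    have : Mono (v n X) := by
      apply D.mono_of_sep
      intro g hg
      have := (hV n X).ker _ D.projG g hg
      rw [D.HJ_last] at this
      exact this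
    have := isIso_of_mono_of_epi (v n X)
    exact h5.iso (asIso (v n X)).symm

end Setup

end Cat4
section Cat5

set_option linter.unusedSectionVars false

/-- the setup attached to a reordering of the simples -/
noncomputable def DeligneData.setup (D : DeligneData k C n) (σ : Equiv.Perm (Fin n)) :
    Setup k C n where
  G := ⨁ D.P
  Q i := D.P (σ i)
  S i := D.S (σ i)
  p i := D.p (σ i)
  inc i := biproduct.ι D.P (σ i)
  prj i := biproduct.π D.P (σ i)
  inc_prj i := biproduct.ι_π_self D.P (σ i)
  inc_prj_ne i j hij := biproduct.ι_π_ne D.P (fun h => hij (σ.injective h))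
  sum_eq := by
    rw [← biproduct.total]
    exact Equiv.sum_comp σ (fun i => biproduct.π D.P i ≫ biproduct.ι D.P i)
  len X := ∑ j, D.mult X j
  len_add T hT := by
    rw [← Finset.sum_add_distrib]
    exact Finset.sum_congr rfl fun j _ => D.mult_additive T hT j
  len_zero X := by
    rw [← D.mult_eq_zero_iff, Finset.sum_eq_zero_iff]
    simp
  homFinite := D.homFinite
  simple i := D.simple _
  distinct i j h := σ.injective (D.distinct _ _ h)
  exhaustive X hX := by
    obtain ⟨i, hi⟩ := D.exhaustive X hX
    exact ⟨σ.symm i, by simpa using hi⟩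
  projCover i := D.projCover _

end Cat5

/-- **Theorem** (Cline–Parshall–Scott). The endomorphism algebra `End (P 0 ⊕ ⋯ ⊕ P (n-1))`
of a projective generator of a Deligne-finite category `A` is a quasi-hereditary algebra
if and only if `A` is highest weight with respect to some ordering of its simple
objects. -/
theorem quasiHereditary_iff_highestWeight_some_order (D : DeligneData k C n) :
    IsQuasiHereditary (End (⨁ D.P)) ↔
      ∃ σ : Equiv.Perm (Fin n), D.IsHighestWeightFor σ := by
  constructor
  · intro h
    let D1 := D.setup 1
    have := D1.finEnd
    obtain ⟨σ, h1, h2⟩ := N_of_qh (K := k) D1.e D1.e_idem D1.e_ne D1.e_sum D1.H1 D1.H2 h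
    exact ⟨σ, (D.setup σ).hw_of_N h1 h2⟩
  · rintro ⟨σ, Δ, q, hmax, hhw⟩
    let D1 := D.setup σ
    have := D1.finEnd
    obtain ⟨h1, h2⟩ := D1.N_of_hw Δ q hmax (fun i => (hhw i).1) (fun i => (hhw i).2)
    have hqh := qh_of_N (K := k) D1.e D1.e_idem D1.e_sum h1 h2
    exact hqh

end HWPaper
end

section
/- Let A be a Deligne-finite k-linear abelian category over an algebraically closed field k, with a fixed ordering S_1,…,S_n of its simple objects, and suppose [Δ_j : S_j] = 1 for each j. Let j^* : A → A/A_{n−1} be the quotient functor with left adjoint j_!, and i_* : A_{n−1} ↪ A the inclusion with left adjoint i^*. Then for each i: j_! j^* P_i ≅ Δ_n^{⊕ [∇_n : S_i]}, the counit and unit give an exact sequence j_! j^* P_i → P_i → i_* i^* P_i → 0, and i^* P_i is a projective cover of S_i in A_{n−1} when i < n and is zero when i = n. -/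
open CategoryTheory CategoryTheory.Limits

universe v u

namespace HWPaper

variable {C : Type u} [Category.{v} C]

variable {k : Type v} [Field k] [IsAlgClosed k] [Abelian C] [Linear k C]
  [EnoughProjectives C] {n : ℕ}

theorem DeligneData.mult_iso (D : DeligneData k C n) {X Y : C} (e : X ≅ Y) (j : Fin n) :
    D.mult X j = D.mult Y j := by
  have hz : IsZero (cokernel e.hom) := by
    refine (isZero_zero C).of_iso (cokernel.ofEpi e.hom)
  have h := D.mult_additive (ShortComplex.mk e.hom (cokernel.π e.hom) (cokernel.condition _))
    { exact := ShortComplex.exact_cokernel _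
      mono_f := inferInstanceAs (Mono e.hom)
      epi_g := inferInstanceAs (Epi (cokernel.π e.hom)) } j
  have h0 := (D.mult_eq_zero_iff _).2 hz j
  dsimp at h
  omega

theorem shortExact_cokernel {X Y : C} (f : X ⟶ Y) [Mono f] :
    (ShortComplex.mk f (cokernel.π f) (cokernel.condition _)).ShortExact :=
  { exact := ShortComplex.exact_cokernel _
    mono_f := inferInstanceAs (Mono f)
    epi_g := inferInstanceAs (Epi (cokernel.π f)) }

theorem DeligneData.extClosure_of_mult (D : DeligneData k C n) (T : Fin n → Prop) (N : ℕ) :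
    ∀ X : C, ∑ j, D.mult X j ≤ N → (∀ j, ¬ T j → D.mult X j = 0) →
      ExtClosure (fun Y => ∃ j, T j ∧ Nonempty (Y ≅ D.S j)) X := by
  induction N with
  | zero =>
    intro X hX _
    apply ExtClosure.zero
    rw [← D.mult_eq_zero_iff]
    intro j
    have := Finset.single_le_sum (f := fun j => D.mult X j) (fun _ _ => Nat.zero_le _)
      (Finset.mem_univ j)
    omega
  | succ N ih =>
    intro X hX hT
    by_cases hz : IsZero X
    · exact ExtClosure.zero _ hz
    by_cases hs : Simple X
    · obtain ⟨j, ⟨e⟩⟩ := D.exhaustive X hs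
      refine ExtClosure.of _ ⟨j, ?_, ⟨e⟩⟩
      by_contra hj
      have := hT j hj
      rw [D.mult_iso e, D.mult_simple] at this
      simp at this
    · have : ∃ (Y : C) (f : Y ⟶ X), Mono f ∧ f ≠ 0 ∧ ¬ IsIso f := by
        by_contra hcon
        push Not at hcon
        apply hs
        refine ⟨fun {Y} f hf => ⟨fun hi h0 => hz ?_, fun h0 => hcon Y f hf h0⟩⟩
        subst h0
        rw [IsZero.iff_id_eq_zero, ← IsIso.inv_hom_id (0 : Y ⟶ X), comp_zero]
      obtain ⟨Y, f, hf, hf0, hfi⟩ := this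
      have hse := shortExact_cokernel f
      have hadd := D.mult_additive _ hse
      dsimp at hadd
      have hsum : ∑ j, D.mult X j = ∑ j, D.mult Y j + ∑ j, D.mult (cokernel f) j := by
        rw [← Finset.sum_add_distrib]
        exact Finset.sum_congr rfl (fun j _ => hadd j)
      have hpos : ∀ Z : C, ¬ IsZero Z → 0 < ∑ j, D.mult Z j := by
        intro Z hZ
        rw [Nat.pos_iff_ne_zero]
        intro h
        apply hZ
        rw [← D.mult_eq_zero_iff]
        intro j
        exact (Finset.sum_eq_zero_iff.1 h) j (Finset.mem_univ j)
      have h1 := hpos Y (fun h => hf0 (h.eq_of_src _ _))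
      have h2 := hpos (cokernel f) (fun h => hfi (by
        have : Epi f := Preadditive.epi_of_isZero_cokernel f h
        exact isIso_of_mono_of_epi f))
      refine ExtClosure.ext _ hse (ih _ ?_ ?_) (ih _ ?_ ?_)
      · dsimp; omega
      · intro j hj; have := hT j hj; have := hadd j; dsimp; omega
      · dsimp; omega
      · intro j hj; have := hT j hj; have := hadd j; dsimp; omega

/-- Any additive function is determined on simples. -/
theorem DeligneData.additive_eq (D : DeligneData k C n) (F : C → ℕ) (i : Fin n)
    (hS : ∀ (X : C) (j : Fin n), Nonempty (X ≅ D.S j) → F X = if j = i then 1 else 0)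
    (h0 : ∀ X, IsZero X → F X = 0)
    (hadd : ∀ T : ShortComplex C, T.ShortExact → F T.X₂ = F T.X₁ + F T.X₃) (X : C) :
    F X = D.mult X i := by
  have h := D.extClosure_of_mult (fun _ => True) _ X le_rfl (fun j hj => absurd trivial hj)
  induction h with
  | of X h =>
    obtain ⟨j, -, ⟨e⟩⟩ := h
    rw [hS X j ⟨e⟩, D.mult_iso e, D.mult_simple]
  | zero X h => rw [h0 X h, (D.mult_eq_zero_iff X).2 h]
  | ext T hT _ _ h1 h3 => rw [hadd T hT, D.mult_additive T hT, h1, h3]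

theorem DeligneData.proj_factor (D : DeligneData k C n) (i j : Fin n) (f : D.P i ⟶ D.S j)
    (hf : f ≠ 0) : ∃ e : D.S j ≅ D.S i, f ≫ e.hom = D.p i := by
  have := D.simple i
  have := D.simple j
  obtain ⟨-, hepi, hsup⟩ := D.projCover i
  have hfe : Epi f := epi_of_nonzero_to_simple hf
  have hz : kernel.ι f ≫ D.p i = 0 := by
    by_contra hne
    have he : Epi (kernel.ι f ≫ D.p i) := epi_of_nonzero_to_simple hne
    have := hsup _ he
    exact hf (by rw [← cancel_epi (kernel.ι f)]; simp)
  let g : D.S j ⟶ D.S i := (Abelian.epiIsCokernelOfKernel (KernelFork.ofι (kernel.ι f) (kernel.condition f)) (kernelIsKernel f)).desc (CokernelCofork.ofπ _ hz)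
  have hg : f ≫ g = D.p i :=
    (Abelian.epiIsCokernelOfKernel (KernelFork.ofι (kernel.ι f) (kernel.condition f)) (kernelIsKernel f)).fac (CokernelCofork.ofπ _ hz) WalkingParallelPair.one
  have hp0 : D.p i ≠ 0 := by
    intro h
    have h1 : (𝟙 (D.S i)) = 0 := by rw [← cancel_epi (D.p i)]; simp [h]
    exact Simple.not_isZero (D.S i) ((IsZero.iff_id_eq_zero _).2 h1)
  have hg0 : g ≠ 0 := by
    intro h
    rw [h, comp_zero] at hg
    exact hp0 hg.symm
  have := isIso_of_hom_simple hg0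
  exact ⟨asIso g, hg⟩

theorem DeligneData.inj_factor (D : DeligneData k C n) (i j : Fin n) (f : D.S j ⟶ D.I i)
    (hf : f ≠ 0) : ∃ e : D.S i ≅ D.S j, e.hom ≫ f = D.ι i := by
  have := D.simple i
  have := D.simple j
  obtain ⟨-, hmono, hsup⟩ := D.injHull i
  have hfe : Mono f := mono_of_nonzero_from_simple hf
  have hz : D.ι i ≫ cokernel.π f = 0 := by
    by_contra hne
    have he : Mono (D.ι i ≫ cokernel.π f) := mono_of_nonzero_from_simple hne
    have := hsup _ he
    exact hf (by rw [← cancel_mono (cokernel.π f)]; simp)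
  let g : D.S i ⟶ D.S j := (Abelian.monoIsKernelOfCokernel (CokernelCofork.ofπ (cokernel.π f) (cokernel.condition f)) (cokernelIsCokernel f)).lift (KernelFork.ofι _ hz)
  have hg : g ≫ f = D.ι i :=
    (Abelian.monoIsKernelOfCokernel (CokernelCofork.ofπ (cokernel.π f) (cokernel.condition f)) (cokernelIsCokernel f)).fac (KernelFork.ofι _ hz) WalkingParallelPair.zero
  have hp0 : D.ι i ≠ 0 := by
    intro h
    have h1 : (𝟙 (D.S i)) = 0 := by rw [← cancel_mono (D.ι i)]; simp [h]
    exact Simple.not_isZero (D.S i) ((IsZero.iff_id_eq_zero _).2 h1)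
  have hg0 : g ≠ 0 := by
    intro h
    rw [h, zero_comp] at hg
    exact hp0 hg.symm
  have := isIso_of_hom_simple hg0
  exact ⟨asIso g, hg⟩

theorem DeligneData.finrank_proj_simple (D : DeligneData k C n) (i j : Fin n) (X : C)
    (e : X ≅ D.S j) :
    Module.finrank k (D.P i ⟶ X) = if j = i then 1 else 0 := by
  have := D.simple i
  have := D.simple j
  have hfin := D.homFinite
  have hpe : Epi (D.p i) := (D.projCover i).2.1
  have h0 : Module.finrank k (D.P i ⟶ X) = Module.finrank k (D.P i ⟶ D.S j) :=
    (Linear.homCongr k (Iso.refl _) e).finrank_eq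
  rw [h0]
  split_ifs with hij
  · subst hij
    have := D.homFinite (D.S j) (D.S j)
    have h1 : Module.finrank k (D.S j ⟶ D.S j) = 1 := finrank_endomorphism_simple_eq_one k _
    rw [← h1]
    refine (LinearEquiv.ofBijective (Linear.leftComp k (D.S j) (D.p j)) ⟨?_, ?_⟩).finrank_eq.symm
    · intro a b hab
      exact (cancel_epi (D.p j)).1 hab
    · intro f
      by_cases hf : f = 0
      · exact ⟨0, by simp [hf]⟩
      · obtain ⟨e, he⟩ := D.proj_factor j j f hf
        exact ⟨e.inv, by simp [← he]⟩
  · have : Subsingleton (D.P i ⟶ D.S j) := by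
      refine ⟨fun a b => ?_⟩
      have : ∀ f : D.P i ⟶ D.S j, f = 0 := by
        intro f
        by_contra hf
        obtain ⟨e, -⟩ := D.proj_factor i j f hf
        exact hij (D.distinct _ _ ⟨e⟩)
      rw [this a, this b]
    exact Module.finrank_zero_of_subsingleton

theorem DeligneData.finrank_simple_inj (D : DeligneData k C n) (i j : Fin n) (X : C)
    (e : X ≅ D.S j) :
    Module.finrank k (X ⟶ D.I i) = if j = i then 1 else 0 := by
  have := D.simple i
  have := D.simple j
  have hfin := D.homFinite
  have hpe : Mono (D.ι i) := (D.injHull i).2.1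
  have h0 : Module.finrank k (X ⟶ D.I i) = Module.finrank k (D.S j ⟶ D.I i) :=
    (Linear.homCongr k e (Iso.refl _)).finrank_eq
  rw [h0]
  split_ifs with hij
  · subst hij
    have := D.homFinite (D.S j) (D.S j)
    have h1 : Module.finrank k (D.S j ⟶ D.S j) = 1 := finrank_endomorphism_simple_eq_one k _
    rw [← h1]
    refine (LinearEquiv.ofBijective (Linear.rightComp k (D.S j) (D.ι j)) ⟨?_, ?_⟩).finrank_eq.symm
    · intro a b hab
      exact (cancel_mono (D.ι j)).1 hab
    · intro f
      by_cases hf : f = 0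
      · exact ⟨0, by simp [hf]⟩
      · obtain ⟨e, he⟩ := D.inj_factor j j f hf
        exact ⟨e.inv, by simp [← he]⟩
  · have : Subsingleton (D.S j ⟶ D.I i) := by
      refine ⟨fun a b => ?_⟩
      have : ∀ f : D.S j ⟶ D.I i, f = 0 := by
        intro f
        by_contra hf
        obtain ⟨e, -⟩ := D.inj_factor i j f hf
        exact hij (D.distinct _ _ ⟨e⟩).symm
      rw [this a, this b]
    exact Module.finrank_zero_of_subsingleton

theorem finrank_add_of_exact {U V W : Type*} [AddCommGroup U] [AddCommGroup V] [AddCommGroup W]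
    [Module k U] [Module k V] [Module k W] [FiniteDimensional k V]
    (f : U →ₗ[k] V) (g : V →ₗ[k] W) (hf : Function.Injective f) (hg : Function.Surjective g)
    (hfg : Function.Exact f g) :
    Module.finrank k V = Module.finrank k U + Module.finrank k W := by
  have h1 := LinearMap.finrank_range_add_finrank_ker g
  rw [LinearMap.range_eq_top.2 hg, finrank_top, LinearMap.exact_iff.1 hfg,
    LinearMap.finrank_range_of_inj hf] at h1
  omega

theorem DeligneData.finrank_proj (D : DeligneData k C n) (i : Fin n) (X : C) :
    Module.finrank k (D.P i ⟶ X) = D.mult X i := by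
  have hproj : Projective (D.P i) := (D.projCover i).1
  refine D.additive_eq (fun X => Module.finrank k (D.P i ⟶ X)) i
    (fun X j ⟨e⟩ => D.finrank_proj_simple i j X e) ?_ ?_ X
  · intro X hX
    have : Subsingleton (D.P i ⟶ X) := ⟨fun a b => hX.eq_of_tgt _ _⟩
    exact Module.finrank_zero_of_subsingleton
  · intro T hT
    have := D.homFinite
    have := hT.mono_f
    have := hT.epi_g
    refine finrank_add_of_exact (Linear.rightComp k (D.P i) T.f) (Linear.rightComp k (D.P i) T.g)
      ?_ ?_ ?_
    · intro a b hab
      exact (cancel_mono T.f).1 hab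
    · intro f
      exact ⟨Projective.factorThru f T.g, Projective.factorThru_comp f T.g⟩
    · intro y
      constructor
      · intro hy
        exact ⟨hT.exact.lift y hy, hT.exact.lift_f y hy⟩
      · rintro ⟨x, rfl⟩
        simp

theorem DeligneData.finrank_inj (D : DeligneData k C n) (i : Fin n) (X : C) :
    Module.finrank k (X ⟶ D.I i) = D.mult X i := by
  have hinj : Injective (D.I i) := (D.injHull i).1
  refine D.additive_eq (fun X => Module.finrank k (X ⟶ D.I i)) i
    (fun X j ⟨e⟩ => D.finrank_simple_inj i j X e) ?_ ?_ X
  · intro X hX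
    have : Subsingleton (X ⟶ D.I i) := ⟨fun a b => hX.eq_of_src _ _⟩
    exact Module.finrank_zero_of_subsingleton
  · intro T hT
    have := D.homFinite
    have := hT.mono_f
    have := hT.epi_g
    rw [add_comm]
    refine finrank_add_of_exact (Linear.leftComp k (D.I i) T.g) (Linear.leftComp k (D.I i) T.f)
      ?_ ?_ ?_
    · intro a b hab
      exact (cancel_epi T.g).1 hab
    · intro f
      exact ⟨Injective.factorThru f T.f, Injective.comp_factorThru f T.f⟩
    · intro y
      constructor
      · intro hy
        exact ⟨hT.exact.desc y hy, hT.exact.g_desc y hy⟩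
      · rintro ⟨x, rfl⟩
        simp

theorem DeligneData.mem_last {n : ℕ} (D : DeligneData k C (n + 1)) (X : C) :
    ExtClosure (fun X => ∃ j, j ≤ Fin.last n ∧ Nonempty (X ≅ D.S j)) X :=
  D.extClosure_of_mult (fun j => j ≤ Fin.last n) _ X le_rfl
    (fun j hj => absurd (Fin.le_last j) hj)

theorem DeligneData.std_last {n : ℕ} (D : DeligneData k C (n + 1)) :
    IsIso (D.q (Fin.last n)) := by
  obtain ⟨h1, -, h3⟩ := D.std (Fin.last n)
  obtain ⟨r, hr⟩ := h3 (𝟙 _) inferInstance (D.mem_last _)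
  have : Mono (D.q (Fin.last n) ≫ r) := by rw [hr]; infer_instance
  have := mono_of_mono (D.q (Fin.last n)) r
  exact isIso_of_mono_of_epi _

theorem DeligneData.costd_last {n : ℕ} (D : DeligneData k C (n + 1)) :
    IsIso (D.m (Fin.last n)) := by
  obtain ⟨h1, -, h3⟩ := D.costd (Fin.last n)
  obtain ⟨r, hr⟩ := h3 (𝟙 _) inferInstance (D.mem_last _)
  have : Epi (r ≫ D.m (Fin.last n)) := by rw [hr]; infer_instance
  have := epi_of_epi r (D.m (Fin.last n))
  exact isIso_of_mono_of_epi _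

theorem DeligneData.mult_last_of_mem {n : ℕ} (D : DeligneData k C (n + 1)) (X : C)
    (h : ExtClosure (fun Y => ∃ j : Fin (n + 1), j.1 < n ∧ Nonempty (Y ≅ D.S j)) X) :
    D.mult X (Fin.last n) = 0 := by
  induction h with
  | of X h =>
    obtain ⟨j, hj, ⟨e⟩⟩ := h
    rw [D.mult_iso e, D.mult_simple, if_neg]
    rintro rfl
    simp at hj
  | zero X h => exact (D.mult_eq_zero_iff X).2 h _
  | ext T hT _ _ h1 h3 => rw [D.mult_additive T hT, h1, h3]

theorem DeligneData.mem_iff {n : ℕ} (D : DeligneData k C (n + 1)) (X : C) :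
    ExtClosure (fun Y => ∃ j : Fin (n + 1), j.1 < n ∧ Nonempty (Y ≅ D.S j)) X ↔
    ∀ f : D.P (Fin.last n) ⟶ X, f = 0 := by
  have hf := D.homFinite (D.P (Fin.last n)) X
  constructor
  · intro h f
    have h1 := D.mult_last_of_mem X h
    rw [← D.finrank_proj, Module.finrank_zero_iff] at h1
    exact Subsingleton.elim _ _
  · intro h
    refine D.extClosure_of_mult (fun j => j.1 < n) _ X le_rfl ?_
    intro j hj
    have : j = Fin.last n := by
      apply Fin.ext
      have := j.2
      simp only [Fin.val_last]
      omega
    subst this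
    rw [← D.finrank_proj, Module.finrank_zero_iff]
    exact ⟨fun a b => by rw [h a, h b]⟩

section Quot

variable {Dq : Type u} [Category.{v} Dq] [Abelian Dq] (jStar : C ⥤ Dq)
  [PreservesFiniteLimits jStar] [PreservesFiniteColimits jStar]
  (jLower : Dq ⥤ C) (adjJ : jLower ⊣ jStar)

theorem isZero_cokernel_counit (hUnit : IsIso adjJ.unit) (X : C) :
    IsZero (jStar.obj (cokernel (adjJ.counit.app X))) := by
  have hi : IsIso (jStar.map (adjJ.counit.app X)) := by
    have h := adjJ.right_triangle_components X
    exact IsIso.of_isIso_fac_left h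
  have := (PreservesCokernel.iso jStar (adjJ.counit.app X))
  exact ((isZero_zero _).of_iso (cokernel.ofEpi _)).of_iso this

theorem isIso_counit_of_proj (hUnit : IsIso adjJ.unit) (X : C) (hP : Projective X)
    (hX : ∀ Y : C, IsZero (jStar.obj Y) → ∀ f : X ⟶ Y, f = 0) :
    IsIso (adjJ.counit.app X) := by
  have hi : IsIso (jStar.map (adjJ.counit.app X)) := by
    have h := adjJ.right_triangle_components X
    exact IsIso.of_isIso_fac_left h
  have he : Epi (adjJ.counit.app X) :=
    Preadditive.epi_of_cokernel_zero (hX _ (isZero_cokernel_counit jStar jLower adjJ hUnit X) _)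
  let s := Projective.factorThru (𝟙 X) (adjJ.counit.app X)
  have hs : s ≫ adjJ.counit.app X = 𝟙 X := Projective.factorThru_comp _ _
  have hz : IsZero (jStar.obj (kernel (adjJ.counit.app X))) :=
    ((isZero_zero _).of_iso (kernel.ofMono _)).of_iso
      (PreservesKernel.iso jStar (adjJ.counit.app X))
  have h0 : ∀ f : jLower.obj (jStar.obj X) ⟶ kernel (adjJ.counit.app X), f = 0 := by
    intro f
    apply (adjJ.homEquiv _ _).injective
    exact hz.eq_of_tgt _ _
  have hid : (𝟙 _ - adjJ.counit.app X ≫ s) ≫ adjJ.counit.app X = 0 := by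
    simp [hs]
  have h1 : adjJ.counit.app X ≫ s = 𝟙 _ := by
    have h2 := kernel.lift_ι (adjJ.counit.app X) _ hid
    rw [h0 (kernel.lift _ _ hid), zero_comp] at h2
    exact (sub_eq_zero.1 h2.symm).symm
  exact ⟨s, h1, hs⟩

theorem isIso_map_of_ker_coker {X Y : C} (f : X ⟶ Y)
    (h1 : IsZero (jStar.obj (kernel f))) (h2 : IsZero (jStar.obj (cokernel f))) :
    IsIso (jStar.map f) := by
  have : Mono (jStar.map f) := Preadditive.mono_of_isZero_kernel _
    (h1.of_iso (PreservesKernel.iso jStar f).symm)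
  have : Epi (jStar.map f) := Preadditive.epi_of_isZero_cokernel _
    (h2.of_iso (PreservesCokernel.iso jStar f).symm)
  exact isIso_of_mono_of_epi _

end Quot

attribute [local instance] CategoryTheory.Abelian.hasFiniteBiproducts

/-- **Lemma** (the inductive step over the top recollement).  Let `A` be Deligne finite with
`n + 1` ordered simple objects and suppose `[Δ j : S j] = 1` for all `j`.  Let
`i_* : B ⥤ A` be the inclusion of the Serre subcategory `A_n` generated by all but the last
simple object (an exact fully faithful functor with essential image `A_n`, with left adjoint
`i^*`), and let `j^* : A ⥤ A/A_n` be the (exact, essentially surjective) Serre quotient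
functor, with kernel `A_n` and left adjoint `j_!` whose unit `id → j^* j_!` is invertible.
Then for each `i`:
* `j_! j^* (P i) ≅ Δ n ^{⊕ [∇ n : S i]}`;
* the counit and unit give an exact sequence `j_! j^* P i ⟶ P i ⟶ i_* i^* P i ⟶ 0`; and
* `i^* (P i)` is a projective cover of `S i` in `A_n` when `i < n`, and is zero when
  `i = n`. -/
theorem recollement_inductive_step {n : ℕ}
    (D : DeligneData k C (n + 1)) (hΔ : ∀ j, D.mult (D.Δ j) j = 1)
    {B : Type u} [Category.{v} B] [Abelian B]
    {Dq : Type u} [Category.{v} Dq] [Abelian Dq]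
    (iStar : B ⥤ C) [iStar.Full] [iStar.Faithful]
    [PreservesFiniteLimits iStar] [PreservesFiniteColimits iStar]
    (hiEss : ∀ X : C,
      ExtClosure (fun Y => ∃ j : Fin (n + 1), j.1 < n ∧ Nonempty (Y ≅ D.S j)) X ↔
        ∃ Yb : B, Nonempty (iStar.obj Yb ≅ X))
    (iLower : C ⥤ B) (adjI : iLower ⊣ iStar)
    (jStar : C ⥤ Dq) [PreservesFiniteLimits jStar] [PreservesFiniteColimits jStar]
    [jStar.EssSurj]
    (hjKer : ∀ X : C, IsZero (jStar.obj X) ↔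
      ExtClosure (fun Y => ∃ j : Fin (n + 1), j.1 < n ∧ Nonempty (Y ≅ D.S j)) X)
    (jLower : Dq ⥤ C) (adjJ : jLower ⊣ jStar) (hUnit : IsIso adjJ.unit)
    (SB : Fin (n + 1) → B)
    (hSB : ∀ i : Fin (n + 1), i ≠ Fin.last n → Nonempty (iStar.obj (SB i) ≅ D.S i))
    (i : Fin (n + 1)) :
    Nonempty (jLower.obj (jStar.obj (D.P i)) ≅
      ⨁ (fun _ : Fin (D.mult (D.nabla (Fin.last n)) i) => D.Δ (Fin.last n))) ∧
    (∃ w : adjJ.counit.app (D.P i) ≫ adjI.unit.app (D.P i) = 0,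
      (ShortComplex.mk (adjJ.counit.app (D.P i)) (adjI.unit.app (D.P i)) w).Exact ∧
      Epi (adjI.unit.app (D.P i))) ∧
    (i ≠ Fin.last n →
      ∃ pb : iLower.obj (D.P i) ⟶ SB i, IsProjCover (iLower.obj (D.P i)) (SB i) pb) ∧
    (i = Fin.last n → IsZero (iLower.obj (D.P i))) := by
  have hmem : ∀ X : C, IsZero (jStar.obj X) ↔ ∀ f : D.P (Fin.last n) ⟶ X, f = 0 :=
    fun X => (hjKer X).trans (D.mem_iff X)
  have hB : ∀ Y : B, IsZero (jStar.obj (iStar.obj Y)) := fun Y =>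
    (hjKer _).2 ((hiEss _).2 ⟨Y, ⟨Iso.refl _⟩⟩)
  have hηepi : ∀ X : C, Epi (adjI.unit.app X) := by
    intro X
    have hz : IsZero (jStar.obj (cokernel (adjI.unit.app X))) := by
      have h1 : Epi (jStar.map (cokernel.π (adjI.unit.app X))) := inferInstance
      exact IsZero.of_epi (jStar.map (cokernel.π (adjI.unit.app X))) (hB _)
    obtain ⟨Z, ⟨e⟩⟩ := (hiEss _).1 ((hjKer _).1 hz)
    apply Preadditive.epi_of_cokernel_zero
    obtain ⟨g, hg⟩ := iStar.map_surjective (cokernel.π (adjI.unit.app X) ≫ e.inv)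
    have hg0 : g = 0 := by
      apply (adjI.homEquiv _ _).injective
      rw [Adjunction.homEquiv_unit, Adjunction.homEquiv_unit, hg]
      simp
    rw [hg0, Functor.map_zero] at hg
    rw [← cancel_mono e.inv, zero_comp, ← hg]
  have hw : adjJ.counit.app (D.P i) ≫ adjI.unit.app (D.P i) = 0 := by
    apply (adjJ.homEquiv _ _).injective
    exact (hB _).eq_of_tgt _ _
  refine ⟨?_, ⟨hw, ?_, hηepi _⟩, ?_, ?_⟩
  · have hq := D.std_last
    have hm := D.costd_last
    have hfin := D.homFinite
    let eΔ := asIso (D.q (Fin.last n))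
    have hPL : Projective (D.P (Fin.last n)) := (D.projCover _).1
    have hΔproj : Projective (D.Δ (Fin.last n)) := Projective.of_iso eΔ hPL
    have hΔ0 : ∀ Y : C, IsZero (jStar.obj Y) → ∀ f : D.Δ (Fin.last n) ⟶ Y, f = 0 := by
      intro Y hY f
      rw [← cancel_epi eΔ.hom, comp_zero]
      exact (hmem Y).1 hY _
    have hmult : D.mult (D.nabla (Fin.last n)) i =
        Module.finrank k (D.Δ (Fin.last n) ⟶ D.P i) := by
      rw [D.mult_iso (asIso (D.m (Fin.last n))), ← D.finrank_proj, D.finrank_inj,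
        ← D.finrank_proj]
      exact (Linear.homCongr k eΔ (Iso.refl _)).finrank_eq
    generalize D.mult (D.nabla (Fin.last n)) i = m at hmult
    have hend : Module.finrank k (D.Δ (Fin.last n) ⟶ D.Δ (Fin.last n)) = 1 := by
      refine Eq.trans ?_ ((D.finrank_proj _ _).trans (hΔ (Fin.last n)))
      exact (Linear.homCongr k eΔ.symm (Iso.refl _)).finrank_eq
    let b : Module.Basis (Fin m) k (D.Δ (Fin.last n) ⟶ D.P i) :=
      Module.finBasisOfFinrankEq k _ hmult.symm
    let W : C := ⨁ (fun _ : Fin m => D.Δ (Fin.last n))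
    let φ : W ⟶ D.P i := biproduct.desc (fun t => b t)
    have hscal : ∀ f : D.Δ (Fin.last n) ⟶ D.Δ (Fin.last n), ∃ c : k, c • 𝟙 _ = f := by
      have hne : (𝟙 (D.Δ (Fin.last n))) ≠ 0 := by
        intro h
        have hz := (IsZero.iff_id_eq_zero _).2 h
        have := hΔ (Fin.last n)
        rw [(D.mult_eq_zero_iff _).2 hz] at this
        omega
      intro f
      exact (finrank_eq_one_iff_of_nonzero' _ hne).1 hend f
    have hφsurj : ∀ f : D.Δ (Fin.last n) ⟶ D.P i, ∃ g : D.Δ (Fin.last n) ⟶ W, g ≫ φ = f := by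
      intro f
      refine ⟨biproduct.lift (fun t => b.repr f t • 𝟙 _), ?_⟩
      rw [biproduct.lift_desc]
      conv_rhs => rw [← b.sum_repr f]
      simp
    have hφinj : ∀ g : D.Δ (Fin.last n) ⟶ W, g ≫ φ = 0 → g = 0 := by
      intro g hg
      choose c hc using fun t => hscal (g ≫ biproduct.π _ t)
      have hg' : g = biproduct.lift (fun t => c t • 𝟙 _) := by
        apply biproduct.hom_ext
        intro t
        rw [biproduct.lift_π, hc]
      rw [hg', biproduct.lift_desc] at hg
      have hc0 := Fintype.linearIndependent_iff.1 b.linearIndependent c (by simpa using hg)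
      rw [hg']
      apply biproduct.hom_ext
      intro t
      simp [hc0 t]
    have hiso : IsIso (jStar.map φ) := by
      apply isIso_map_of_ker_coker
      · rw [hmem]
        intro f
        have h1 : (eΔ.inv ≫ f ≫ kernel.ι φ) = 0 := hφinj _ (by simp)
        rw [← cancel_epi eΔ.inv, ← cancel_mono (kernel.ι φ)]
        simpa using h1
      · rw [hmem]
        intro f
        let f' := Projective.factorThru f (cokernel.π φ)
        have hf' : f' ≫ cokernel.π φ = f := Projective.factorThru_comp _ _
        obtain ⟨g, hg⟩ := hφsurj (eΔ.inv ≫ f')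
        rw [← hf', ← cancel_epi eΔ.inv, ← Category.assoc, ← hg]
        simp
    have hWproj : Projective W := by
      refine ⟨fun {E X} f e he => ⟨biproduct.desc (fun t =>
        Projective.factorThru (biproduct.ι (fun _ : Fin m => D.Δ (Fin.last n)) t ≫ f) e), ?_⟩⟩
      apply biproduct.hom_ext'
      intro t
      rw [biproduct.ι_desc_assoc, Projective.factorThru_comp]
    have hcounit : IsIso (adjJ.counit.app W) := by
      apply isIso_counit_of_proj jStar jLower adjJ hUnit W hWproj
      intro Y hY f
      apply biproduct.hom_ext'
      intro t
      rw [comp_zero]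
      exact hΔ0 Y hY _
    exact ⟨(jLower.mapIso (asIso (jStar.map φ))).symm ≪≫ asIso (adjJ.counit.app W)⟩
  · have hz := isZero_cokernel_counit jStar jLower adjJ hUnit (D.P i)
    obtain ⟨Z, ⟨e⟩⟩ := (hiEss _).1 ((hjKer _).1 hz)
    rw [ShortComplex.exact_iff_mono_cokernel_desc]
    let g := (adjI.homEquiv _ _).symm (cokernel.π (adjJ.counit.app (D.P i)) ≫ e.inv)
    have hg : adjI.unit.app (D.P i) ≫ iStar.map g =
        cokernel.π (adjJ.counit.app (D.P i)) ≫ e.inv := by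
      exact (Adjunction.homEquiv_unit adjI _ _ _).symm.trans (Equiv.apply_symm_apply _ _)
    have hfac : cokernel.desc (adjJ.counit.app (D.P i)) (adjI.unit.app (D.P i)) hw ≫
        iStar.map g = e.inv := by
      rw [← cancel_epi (cokernel.π (adjJ.counit.app (D.P i))), cokernel.π_desc_assoc, hg]
    have : Mono (cokernel.desc (adjJ.counit.app (D.P i)) (adjI.unit.app (D.P i)) hw ≫
        iStar.map g) := by rw [hfac]; infer_instance
    exact mono_of_mono _ (iStar.map g)
  · intro hi
    obtain ⟨e⟩ := hSB i hi
    obtain ⟨hproj, hepi, hsup⟩ := D.projCover i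
    let pb := (adjI.homEquiv _ _).symm (D.p i ≫ e.inv)
    have hpb : adjI.unit.app (D.P i) ≫ iStar.map pb = D.p i ≫ e.inv := by
      exact (Adjunction.homEquiv_unit adjI _ _ _).symm.trans (Equiv.apply_symm_apply _ _)
    refine ⟨pb, adjI.map_projective _ hproj, ?_, ?_⟩
    · have : Epi (adjI.unit.app (D.P i) ≫ iStar.map pb) := by rw [hpb]; infer_instance
      have := epi_of_epi (adjI.unit.app (D.P i)) (iStar.map pb)
      exact iStar.epi_of_epi_map this
    · intro Y f hf
      have hη := hηepi (D.P i)
      have hf2 : Epi (iStar.map f ≫ iStar.map pb) := by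
        rw [← Functor.map_comp]; infer_instance
      have hcond := pullback.condition (f := adjI.unit.app (D.P i)) (g := iStar.map f)
      have h1 : Epi (pullback.fst (adjI.unit.app (D.P i)) (iStar.map f)) := by
        apply hsup
        have h2 : pullback.fst (adjI.unit.app (D.P i)) (iStar.map f) ≫ D.p i =
            (pullback.snd (adjI.unit.app (D.P i)) (iStar.map f) ≫
              (iStar.map f ≫ iStar.map pb)) ≫ e.hom := by
          rw [← Category.assoc (pullback.snd _ _), ← hcond, Category.assoc, Category.assoc]

          rw [← Category.assoc (adjI.unit.app (D.P i)), hpb]; simp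
        rw [h2]
        have : Epi (pullback.snd (adjI.unit.app (D.P i)) (iStar.map f)) := inferInstance
        infer_instance
      have h3 : Epi (pullback.snd (adjI.unit.app (D.P i)) (iStar.map f) ≫ iStar.map f) := by
        rw [← hcond]; infer_instance
      have := epi_of_epi (pullback.snd (adjI.unit.app (D.P i)) (iStar.map f)) (iStar.map f)
      exact iStar.epi_of_epi_map this
  · rintro rfl
    rw [IsZero.iff_id_eq_zero]
    apply (adjI.homEquiv _ _).injective
    rw [(hmem _).1 (hB _) ((adjI.homEquiv _ _) (𝟙 _)), (hmem _).1 (hB _) ((adjI.homEquiv _ _) 0)]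

end HWPaper
end
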